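/- arXiv:2303.04453 — 2 statements merged into one kernel-verified Lean document; each statement's English description precedes it below -/
import Mathlib

section
/- Let X be the 7-vertex graph obtained from a 4-cycle by adding a new vertex w adjacent to exactly one vertex of the cycle, and then adding two pendant vertices each adjacent only to w. Then the class of X-free chordal bipartite graphs is factorial: there exist constants c₁, c₂ > 0 and N such that for every n ≥ N, the number of simple graphs on the labeled vertex set {1, …, n} that are chordal bipartite and X-free is at least n^(c₁·n) and at most n^(c₂·n). -/
open SimpleGraph

/-- The graph `X`: a 4-cycle `0-1-2-3-0`, a new vertex `4` adjacent to exactly one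
vertex (`0`) of the cycle, and two pendant vertices `5, 6` each adjacent only to `4`. -/
def Xgraph : SimpleGraph (Fin 7) :=
  SimpleGraph.fromRel fun i j =>
    ((i : ℕ), (j : ℕ)) ∈ [(0,1),(1,2),(2,3),(3,0),(0,4),(4,5),(4,6)]

/-- Chordal bipartite: bipartite with no induced cycle of length 6 or more. -/
def ChordalBipartite {V : Type*} (G : SimpleGraph V) : Prop :=
  G.Colorable 2 ∧ ∀ m : ℕ, 6 ≤ m → ¬ Nonempty (SimpleGraph.cycleGraph m ↪g G)

theorem exists_order {V : Type*} [Fintype V] (G : SimpleGraph V) :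
    ∃ f : V → ℕ, Function.Injective f ∧ ∀ u v x, ¬ G.Adj u v → f u < f v → G.Adj u x →
      ¬ G.Adj v x → ∃ y, G.Adj v y ∧ ¬ G.Adj u y ∧ f x < f y ∧
        ∀ z, f y < f z → (G.Adj u z ↔ G.Adj v z) := by
  classical
  let A : Matrix V V ℤ := G.adjMatrix ℤ
  let W : (V ≃ Fin (Fintype.card V)) → V → ℤ := fun σ x => 2 ^ (σ x : ℕ)
  let Φ : (V ≃ Fin (Fintype.card V)) → ℤ := fun σ => W σ ⬝ᵥ A.mulVec (W σ)
  have : Nonempty (V ≃ Fin (Fintype.card V)) := ⟨Fintype.equivFin V⟩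
  obtain ⟨σ, hσ⟩ := Finite.exists_max Φ
  have hinj : Function.Injective (fun x => (σ x : ℕ)) := fun x y h => σ.injective (Fin.ext h)
  refine ⟨fun x => (σ x : ℕ), hinj, ?_⟩
  intro u v x huv hlt hux hvx
  have hne : u ≠ v := by rintro rfl; exact hvx hux
  -- the row weights are ordered
  have hr : ∑ y ∈ G.neighborFinset u, (2:ℤ) ^ (σ y : ℕ) ≤
      ∑ y ∈ G.neighborFinset v, (2:ℤ) ^ (σ y : ℕ) := by
    have h := hσ ((Equiv.swap u v).trans σ)
    set δ : ℤ := W σ v - W σ u with hδ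
    have hδpos : 0 < δ := by
      simp only [hδ, W, sub_pos]
      exact pow_lt_pow_right₀ (by norm_num) hlt
    have hW : W ((Equiv.swap u v).trans σ) = W σ + (Pi.single u δ - Pi.single v δ) := by
      funext z
      by_cases hzu : z = u
      · subst hzu; simp [W, hne, hδ]
      · by_cases hzv : z = v
        · subst hzv; simp [W, hne.symm, hδ]
        · simp [W, hzu, hzv, Equiv.swap_apply_of_ne_of_ne]
    have hsym : ∀ p q : V → ℤ, p ⬝ᵥ A.mulVec q = q ⬝ᵥ A.mulVec p := by
      intro p q
      rw [Matrix.dotProduct_mulVec, dotProduct_comm, ← Matrix.mulVec_transpose]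
      simp [A]
    have hu : (A.mulVec (W σ)) u = ∑ y ∈ G.neighborFinset u, (2:ℤ) ^ (σ y : ℕ) := by
      simp [A, W, SimpleGraph.adjMatrix_mulVec_apply]
    have hv : (A.mulVec (W σ)) v = ∑ y ∈ G.neighborFinset v, (2:ℤ) ^ (σ y : ℕ) := by
      simp [A, W, SimpleGraph.adjMatrix_mulVec_apply]
    have hvu : ¬ G.Adj v u := fun h => huv h.symm
    have key : Φ ((Equiv.swap u v).trans σ) = Φ σ + 2 * δ *
        ((A.mulVec (W σ)) u - (A.mulVec (W σ)) v) := by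
      simp only [Φ, hW]
      rw [Matrix.mulVec_add, add_dotProduct, dotProduct_add, dotProduct_add, hsym (W σ) (_ - _)]
      have h0 : (Pi.single u δ - Pi.single v δ) ⬝ᵥ A.mulVec (Pi.single u δ - Pi.single v δ) = 0 := by
        rw [Matrix.mulVec_sub, sub_dotProduct, dotProduct_sub, dotProduct_sub]
        simp [A, huv, hvu]
      rw [h0, sub_dotProduct]
      simp
      ring
    rw [key, hu, hv] at h
    by_contra hcon
    push Not at hcon
    nlinarith [mul_pos hδpos (sub_pos.2 hcon)]
  -- the last difference
  let D : Finset V := Finset.univ.filter fun z => ¬ (G.Adj u z ↔ G.Adj v z)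
  have hD : D.Nonempty := ⟨x, by simp [D, hux, hvx]⟩
  obtain ⟨y, hyD, hymax⟩ := D.exists_max_image (fun x => (σ x : ℕ)) hD
  have hy : ¬ (G.Adj u y ↔ G.Adj v y) := by simpa [D] using hyD
  have hmax : ∀ z, (σ y : ℕ) < σ z → (G.Adj u z ↔ G.Adj v z) := by
    intro z hz
    by_contra hcon
    have := hymax z (by simpa [D] using hcon)
    exact absurd this (not_le.2 hz)
  have hle : (σ x : ℕ) ≤ σ y := hymax x (by simp [D, hux, hvx])
  by_cases hvy : G.Adj v y
  · have huy : ¬ G.Adj u y := by tauto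
    refine ⟨y, hvy, huy, lt_of_le_of_ne hle ?_, hmax⟩
    intro h
    have := hinj h
    subst this
    exact hvx hvy
  · exfalso
    have huy : G.Adj u y := by tauto
    have e : ∀ w, ∑ y ∈ G.neighborFinset w, (2:ℤ) ^ (σ y : ℕ) =
        ((∑ k ∈ (G.neighborFinset w).image (fun x => (σ x : ℕ)), 2 ^ k : ℕ) : ℤ) := by
      intro w
      rw [Finset.sum_image (fun a _ b _ h => hinj h)]
      push_cast; rfl
    rw [e, e, Nat.cast_le, Finset.geomSum_le_geomSum_iff_toColex_le_toColex (le_refl 2),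
      Finset.Colex.toColex_le_toColex] at hr
    obtain ⟨b, hb1, hb2, hb3⟩ := hr (a := (σ y : ℕ)) (Finset.mem_image.2 ⟨y, by simpa using huy, rfl⟩) (by
      intro hm
      obtain ⟨z, hz, hzy⟩ := Finset.mem_image.1 hm
      have := hinj hzy
      subst this
      exact hvy (by simpa using hz))
    obtain ⟨z, hz, rfl⟩ := Finset.mem_image.1 hb1
    have hvz : G.Adj v z := by simpa using hz
    have huz : ¬ G.Adj u z := fun h => hb2 (Finset.mem_image.2 ⟨z, by simpa using h, rfl⟩)
    rcases hb3.lt_or_eq with h | h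
    · exact huz ((hmax z h).2 hvz)
    · have := hinj h
      subst this
      exact hvy hvz

theorem cycle_of_ladder {V : Type*} (G : SimpleGraph V) (c : V → Bool)
    (hc : ∀ u v, G.Adj u v → c u ≠ c v) (M : ℕ) (hM : 2 ≤ M) (col : Bool) (a b : ℕ → V)
    (ha : ∀ k, k ≤ M → c (a k) = col) (hb : ∀ k, k ≤ M → c (b k) = !col)
    (hai : ∀ k l, k ≤ M → l ≤ M → a k = a l → k = l)
    (hbi : ∀ k l, k ≤ M → l ≤ M → b k = b l → k = l)
    (hab : ∀ k l, k ≤ M → l ≤ M → (G.Adj (a k) (b l) ↔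
      ((k = 0 ∧ l = 0) ∨ (k = M ∧ l = M) ∨ k = l + 1 ∨ l = k + 1))) :
    Nonempty (SimpleGraph.cycleGraph (2 * M + 2) ↪g G) := by
  let s : ℕ → ℕ := fun t => if t ≤ M then t else 2 * M + 1 - t
  let φ : ℕ → V := fun t =>
    if (t % 2 = 0 ∧ t ≤ M) ∨ (t % 2 = 0 ∧ ¬ t ≤ M) then a (s t) else b (s t)
  have hφa : ∀ t, t % 2 = 0 → φ t = a (s t) := by intro t h; simp only [φ]; rw [if_pos (by omega)]
  have hφb : ∀ t, t % 2 = 1 → φ t = b (s t) := by intro t h; simp only [φ]; rw [if_neg (by omega)]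
  have hs : ∀ t, t < 2 * M + 2 → s t ≤ M := by intro t ht; simp only [s]; split_ifs <;> omega
  have haa : ∀ k l, k ≤ M → l ≤ M → ¬ G.Adj (a k) (a l) := by
    intro k l hk hl h; exact hc _ _ h (by rw [ha k hk, ha l hl])
  have hbb : ∀ k l, k ≤ M → l ≤ M → ¬ G.Adj (b k) (b l) := by
    intro k l hk hl h; exact hc _ _ h (by rw [hb k hk, hb l hl])
  have hne : ∀ k l, k ≤ M → l ≤ M → a k ≠ b l := by
    intro k l hk hl h
    have := ha k hk
    rw [h, hb l hl] at this
    cases col <;> simp at this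
  have hinj : ∀ t t', t < 2 * M + 2 → t' < 2 * M + 2 → φ t = φ t' → t = t' := by
    intro t t' ht ht' h
    rcases Nat.mod_two_eq_zero_or_one t with h1 | h1 <;>
    rcases Nat.mod_two_eq_zero_or_one t' with h2 | h2
    · rw [hφa _ h1, hφa _ h2] at h
      have := hai _ _ (hs t ht) (hs t' ht') h
      simp only [s] at this
      split_ifs at this <;> omega
    · rw [hφa _ h1, hφb _ h2] at h
      exact absurd h (hne _ _ (hs t ht) (hs t' ht'))
    · rw [hφb _ h1, hφa _ h2] at h
      exact absurd h.symm (hne _ _ (hs t' ht') (hs t ht))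
    · rw [hφb _ h1, hφb _ h2] at h
      have := hbi _ _ (hs t ht) (hs t' ht') h
      simp only [s] at this
      split_ifs at this <;> omega
  have hadj0 : ∀ t t', t < 2 * M + 2 → t' < 2 * M + 2 → t % 2 = 0 → t' % 2 = 1 →
      (G.Adj (φ t) (φ t') ↔ (t + 1 = t' ∨ t' + 1 = t ∨ (t = 0 ∧ t' = 2 * M + 1))) := by
    intro t t' ht ht' h1 h2
    rw [hφa _ h1, hφb _ h2, hab _ _ (hs t ht) (hs t' ht')]
    simp only [s]
    split_ifs <;> omega
  have hadj : ∀ t t', t < 2 * M + 2 → t' < 2 * M + 2 →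
      (G.Adj (φ t) (φ t') ↔ (t + 1 = t' ∨ t' + 1 = t ∨ (t = 0 ∧ t' = 2 * M + 1) ∨
        (t' = 0 ∧ t = 2 * M + 1))) := by
    intro t t' ht ht'
    rcases Nat.mod_two_eq_zero_or_one t with h1 | h1 <;>
    rcases Nat.mod_two_eq_zero_or_one t' with h2 | h2
    · rw [hφa _ h1, hφa _ h2]
      have := haa _ _ (hs t ht) (hs t' ht')
      constructor
      · intro h; exact absurd h this
      · intro h; omega
    · rw [hadj0 t t' ht ht' h1 h2]; omega
    · rw [G.adj_comm, hadj0 t' t ht' ht h2 h1]; omega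
    · rw [hφb _ h1, hφb _ h2]
      have := hbb _ _ (hs t ht) (hs t' ht')
      constructor
      · intro h; exact absurd h this
      · intro h; omega
  refine ⟨⟨⟨fun t => φ t.val, fun t t' h => Fin.ext (hinj _ _ t.2 t'.2 h)⟩, ?_⟩⟩
  intro t t'
  change G.Adj (φ t.val) (φ t'.val) ↔ _
  rw [hadj _ _ t.2 t'.2, SimpleGraph.cycleGraph_adj']
  have e : ∀ p q : Fin (2 * M + 2), (p - q).val = if q.val ≤ p.val then p.val - q.val else
      2 * M + 2 + p.val - q.val := by
    intro p q
    rw [Fin.sub_def]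
    simp only
    have := p.2
    have := q.2
    split_ifs with h
    · rw [show 2 * M + 2 - q.val + p.val = (p.val - q.val) + (2 * M + 2) by omega, Nat.add_mod_right,
        Nat.mod_eq_of_lt (by omega)]
    · rw [Nat.mod_eq_of_lt (by omega)]; omega
  rw [e, e]
  have := t.2
  have := t'.2
  split_ifs <;> omega

theorem gamma_free {V : Type*} [Fintype V] (G : SimpleGraph V) (c : V → Bool)
    (hc : ∀ u v, G.Adj u v → c u ≠ c v)
    (hcyc : ∀ m : ℕ, 6 ≤ m → ¬ Nonempty (SimpleGraph.cycleGraph m ↪g G))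
    (f : V → ℕ)
    (hf : ∀ u v x, ¬ G.Adj u v → f u < f v → G.Adj u x →
      ¬ G.Adj v x → ∃ y, G.Adj v y ∧ ¬ G.Adj u y ∧ f x < f y ∧
        ∀ z, f y < f z → (G.Adj u z ↔ G.Adj v z))
    (v a₁ a₂ w : V) (h1 : G.Adj v a₁) (h2 : G.Adj v a₂) (h12 : f a₁ < f a₂) (hw : G.Adj a₁ w)
    (hvw : f v < f w) : G.Adj a₂ w := by
  by_contra hcon
  have main : ∀ m, 1 ≤ m → ∃ a b : ℕ → V,
      (∀ k, k ≤ m → c (a k) = c v) ∧ (∀ k, k ≤ m → c (b k) = !(c v)) ∧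
      (∀ k l, k < l → l ≤ m → f (a k) < f (a l)) ∧
      (∀ k l, k < l → l ≤ m → f (b k) < f (b l)) ∧
      (∀ k l, k ≤ m → l ≤ m → (G.Adj (a k) (b l) ↔
        ((k = 0 ∧ l = 0) ∨ k = l + 1 ∨ l = k + 1))) ∧
      (∀ k, k + 2 ≤ m → ∀ z, f (b (k+2)) < f z → (G.Adj (a k) z ↔ G.Adj (a (k+1)) z)) ∧
      (∀ k, k + 2 ≤ m → ∀ z, f (a (k+2)) < f z → (G.Adj (b k) z ↔ G.Adj (b (k+1)) z)) := by
    have hcol : ∀ u v, G.Adj u v → c v = !(c u) := by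
      intro u v h
      have := hc u v h
      revert this
      cases c u <;> cases c v <;> simp
    intro m hm
    induction m, hm using Nat.le_induction with
    | base =>
      refine ⟨fun k => if k = 0 then v else w, fun k => if k = 0 then a₁ else a₂, ?_, ?_, ?_, ?_,
        ?_, ?_, ?_⟩
      · intro k hk
        have := hcol _ _ h1
        have := hcol _ _ hw
        dsimp only
        split_ifs <;> simp [*]
      · intro k hk
        have := hcol _ _ h1
        have := hcol _ _ h2
        dsimp only
        split_ifs <;> simp [*]
      · intro k l hkl hl
        have : k = 0 := by omega
        have : l = 1 := by omega
        subst k l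
        simpa using hvw
      · intro k l hkl hl
        have : k = 0 := by omega
        have : l = 1 := by omega
        subst k l
        simpa using h12
      · intro k l hk hl
        have hw' := hw.symm
        have hcon' : ¬ G.Adj w a₂ := fun h => hcon h.symm
        interval_cases k <;> interval_cases l <;> simp [h1, h2, hw', hcon']
      · intro k hk; omega
      · intro k hk; omega
    | succ m hm ih =>
      obtain ⟨a, b, ha, hb, hfa, hfb, hab, hta, htb⟩ := ih
      have haa : ∀ k l, k ≤ m → l ≤ m → ¬ G.Adj (a k) (a l) := by
        intro k l hk hl h; exact hc _ _ h (by rw [ha k hk, ha l hl])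
      have hbb : ∀ k l, k ≤ m → l ≤ m → ¬ G.Adj (b k) (b l) := by
        intro k l hk hl h; exact hc _ _ h (by rw [hb k hk, hb l hl])
      obtain ⟨y, hy1, hy2, hy3, hy4⟩ := hf (a (m-1)) (a m) (b m) (haa _ _ (by omega) le_rfl)
        (hfa _ _ (by omega) le_rfl) ((hab _ _ (by omega) le_rfl).2 (by omega))
        (fun h => by have := (hab _ _ le_rfl le_rfl).1 h; omega)
      obtain ⟨x, hx1, hx2, hx3, hx4⟩ := hf (b (m-1)) (b m) (a m) (hbb _ _ (by omega) le_rfl)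
        (hfb _ _ (by omega) le_rfl) ((hab _ _ le_rfl (by omega)).2 (by omega)).symm
        (fun h => by have := (hab _ _ le_rfl le_rfl).1 h.symm; omega)
      have hya : ∀ k, k ≤ m → (G.Adj (a k) y ↔ k = m) := by
        have : ∀ d, d + 1 ≤ m → ¬ G.Adj (a (m - 1 - d)) y := by
          intro d
          induction d with
          | zero => intro _; exact hy2
          | succ d ihd =>
            intro hd
            rw [hta (m - 1 - (d+1)) (by omega) y ?_]
            · rw [show m - 1 - (d + 1) + 1 = m - 1 - d by omega]; exact ihd (by omega)
            · rcases Nat.lt_or_ge (m - 1 - (d+1) + 2) m with h | h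
              · exact (hfb _ _ h le_rfl).trans hy3
              · rw [show m - 1 - (d + 1) + 2 = m by omega]; exact hy3
        intro k hk
        constructor
        · intro h
          by_contra hne
          have := this (m - 1 - k) (by omega)
          rw [show m - 1 - (m - 1 - k) = k by omega] at this
          exact this h
        · rintro rfl; exact hy1
      have hxb : ∀ k, k ≤ m → (G.Adj x (b k) ↔ k = m) := by
        have : ∀ d, d + 1 ≤ m → ¬ G.Adj (b (m - 1 - d)) x := by
          intro d
          induction d with
          | zero => intro _; exact hx2
          | succ d ihd =>
            intro hd
            rw [htb (m - 1 - (d+1)) (by omega) x ?_]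
            · rw [show m - 1 - (d + 1) + 1 = m - 1 - d by omega]; exact ihd (by omega)
            · rcases Nat.lt_or_ge (m - 1 - (d+1) + 2) m with h | h
              · exact (hfa _ _ h le_rfl).trans hx3
              · rw [show m - 1 - (d + 1) + 2 = m by omega]; exact hx3
        intro k hk
        constructor
        · intro h
          by_contra hne
          have := this (m - 1 - k) (by omega)
          rw [show m - 1 - (m - 1 - k) = k by omega] at this
          exact this h.symm
        · rintro rfl; exact hx1.symm
      let a' : ℕ → V := fun k => if k ≤ m then a k else x
      let b' : ℕ → V := fun k => if k ≤ m then b k else y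
      have ea : ∀ k, k ≤ m → a' k = a k := fun k hk => if_pos hk
      have eb : ∀ k, k ≤ m → b' k = b k := fun k hk => if_pos hk
      have ea1 : a' (m+1) = x := if_neg (by omega)
      have eb1 : b' (m+1) = y := if_neg (by omega)
      have cases1 : ∀ k, k ≤ m + 1 → k ≤ m ∨ k = m + 1 := by intro k hk; omega
      have Ha : ∀ k, k ≤ m + 1 → c (a' k) = c v := by
        intro k hk
        rcases cases1 k hk with h | rfl
        · rw [ea k h, ha k h]
        · rw [ea1, hcol _ _ hx1, hb m le_rfl]; simp
      have Hb : ∀ k, k ≤ m + 1 → c (b' k) = !(c v) := by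
        intro k hk
        rcases cases1 k hk with h | rfl
        · rw [eb k h, hb k h]
        · rw [eb1, hcol _ _ hy1, ha m le_rfl]
      have Hfa : ∀ k l, k < l → l ≤ m + 1 → f (a' k) < f (a' l) := by
        intro k l hkl hl
        rcases cases1 l hl with h | rfl
        · rw [ea k (by omega), ea l h]; exact hfa _ _ hkl h
        · rw [ea1, ea k (by omega)]
          rcases Nat.lt_or_ge k m with h | h
          · exact (hfa _ _ h le_rfl).trans hx3
          · rw [show k = m by omega]; exact hx3
      have Hfb : ∀ k l, k < l → l ≤ m + 1 → f (b' k) < f (b' l) := by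
        intro k l hkl hl
        rcases cases1 l hl with h | rfl
        · rw [eb k (by omega), eb l h]; exact hfb _ _ hkl h
        · rw [eb1, eb k (by omega)]
          rcases Nat.lt_or_ge k m with h | h
          · exact (hfb _ _ h le_rfl).trans hy3
          · rw [show k = m by omega]; exact hy3
      have Hai : ∀ k l, k ≤ m + 1 → l ≤ m + 1 → a' k = a' l → k = l := by
        intro k l hk hl h
        rcases lt_trichotomy k l with h' | h' | h'
        · have := Hfa _ _ h' hl; rw [h] at this; omega
        · exact h'
        · have := Hfa _ _ h' hk; rw [h] at this; omega
      have Hbi : ∀ k l, k ≤ m + 1 → l ≤ m + 1 → b' k = b' l → k = l := by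
        intro k l hk hl h
        rcases lt_trichotomy k l with h' | h' | h'
        · have := Hfb _ _ h' hl; rw [h] at this; omega
        · exact h'
        · have := Hfb _ _ h' hk; rw [h] at this; omega
      have hxy : ¬ G.Adj x y := by
        intro hxy
        refine hcyc (2 * (m+1) + 2) (by omega) (cycle_of_ladder G c hc (m+1) (by omega) (c v) a' b'
          Ha Hb Hai Hbi ?_)
        intro k l hk hl
        rcases cases1 k hk with h | rfl <;> rcases cases1 l hl with h' | rfl
        · rw [ea k h, eb l h', hab _ _ h h']; omega
        · rw [ea k h, eb1, hya k h]; omega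
        · rw [ea1, eb l h', hxb l h']; omega
        · rw [ea1, eb1]; simp [hxy]
      refine ⟨a', b', Ha, Hb, Hfa, Hfb, ?_, ?_, ?_⟩
      · intro k l hk hl
        rcases cases1 k hk with h | rfl <;> rcases cases1 l hl with h' | rfl
        · rw [ea k h, eb l h', hab _ _ h h']
        · rw [ea k h, eb1, hya k h]; omega
        · rw [ea1, eb l h', hxb l h']; omega
        · rw [ea1, eb1]; simp [hxy]
      · intro k hk z hz
        rcases cases1 (k+2) hk with h | h
        · rw [ea k (by omega), ea (k+1) (by omega)]
          rw [eb (k+2) h] at hz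
          exact hta k h z hz
        · rw [h, eb1] at hz
          rw [ea k (by omega), ea (k+1) (by omega), show k = m - 1 by omega,
            show m - 1 + 1 = m by omega]
          exact hy4 z hz
      · intro k hk z hz
        rcases cases1 (k+2) hk with h | h
        · rw [eb k (by omega), eb (k+1) (by omega)]
          rw [ea (k+2) h] at hz
          exact htb k h z hz
        · rw [h, ea1] at hz
          rw [eb k (by omega), eb (k+1) (by omega), show k = m - 1 by omega,
            show m - 1 + 1 = m by omega]
          exact hx4 z hz
  obtain ⟨a, b, -, -, hfa, -⟩ := main (Fintype.card V + 1) (by omega)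
  have hinj : Function.Injective (fun k : Fin (Fintype.card V + 1) => a k.val) := by
    intro k l h
    have h : a k.val = a l.val := h
    rcases lt_trichotomy k.val l.val with h' | h' | h'
    · have := hfa _ _ h' (by omega); rw [h] at this; omega
    · exact Fin.ext h'
    · have := hfa _ _ h' (by omega); rw [h] at this; omega
  have := Fintype.card_le_of_injective _ hinj
  simp at this

theorem mk_X {V : Type*} (G : SimpleGraph V) (c : V → Bool)
    (hc : ∀ u v, G.Adj u v → c u ≠ c v) (x0 x1 x2 x3 x4 x5 x6 : V)
    (h01 : G.Adj x0 x1) (h12 : G.Adj x1 x2) (h23 : G.Adj x2 x3) (h30 : G.Adj x3 x0)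
    (h04 : G.Adj x0 x4) (h45 : G.Adj x4 x5) (h46 : G.Adj x4 x6)
    (n24 : ¬ G.Adj x2 x4) (n15 : ¬ G.Adj x1 x5) (n16 : ¬ G.Adj x1 x6)
    (n35 : ¬ G.Adj x3 x5) (n36 : ¬ G.Adj x3 x6) (d13 : x1 ≠ x3) (d56 : x5 ≠ x6) :
    Nonempty (Xgraph ↪g G) := by
  have hcol : ∀ u v, G.Adj u v → c v = !(c u) := by
    intro u v h
    have := hc u v h
    revert this
    cases c u <;> cases c v <;> simp
  have c1 := hcol _ _ h01
  have c2 := hcol _ _ h12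
  have c3 := hcol _ _ h23
  have c4 := hcol _ _ h04
  have c5 := hcol _ _ h45
  have c6 := hcol _ _ h46
  rw [c1] at c2
  rw [c2] at c3
  rw [c4] at c5 c6
  simp only [Bool.not_not] at c1 c2 c3 c4 c5 c6
  have same : ∀ u v, c u = c v → ¬ G.Adj u v := fun u v h h' => hc u v h' h
  have diff : ∀ u v, c u = !(c v) → u ≠ v := by
    rintro u v h rfl
    revert h
    cases c u <;> simp
  have n02 := same x0 x2 (by simp [c2])
  have n05 := same x0 x5 (by simp [c5])
  have n06 := same x0 x6 (by simp [c6])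
  have n25 := same x2 x5 (by simp [c2, c5])
  have n26 := same x2 x6 (by simp [c2, c6])
  have n56 := same x5 x6 (by simp [c5, c6])
  have n13 := same x1 x3 (by simp [c1, c3])
  have n14 := same x1 x4 (by simp [c1, c4])
  have n34 := same x3 x4 (by simp [c3, c4])
  have d01 := h01.ne
  have d12 := h12.ne
  have d23 := h23.ne
  have d30 := h30.ne
  have d04 := h04.ne
  have d45 := h45.ne
  have d46 := h46.ne
  have d24 := (diff x2 x4 (by simp [c2, c4]))
  have d15 := (diff x1 x5 (by simp [c1, c5]))
  have d16 := (diff x1 x6 (by simp [c1, c6]))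
  have d35 := (diff x3 x5 (by simp [c3, c5]))
  have d36 := (diff x3 x6 (by simp [c3, c6]))
  have d02 : x0 ≠ x2 := by rintro rfl; exact n24 h04
  have d05 : x0 ≠ x5 := by rintro rfl; exact n15 h01.symm
  have d06 : x0 ≠ x6 := by rintro rfl; exact n16 h01.symm
  have d25 : x2 ≠ x5 := by rintro rfl; exact n15 h12
  have d26 : x2 ≠ x6 := by rintro rfl; exact n16 h12
  have d14 : x1 ≠ x4 := by rintro rfl; exact n15 h45
  have d34 : x3 ≠ x4 := by rintro rfl; exact n35 h45
  refine ⟨⟨⟨![x0, x1, x2, x3, x4, x5, x6], ?_⟩, ?_⟩⟩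
  · intro i j h
    fin_cases i <;> fin_cases j <;> first | rfl | (exfalso; revert h; simp [*, Ne.symm, eq_comm])
  · intro i j
    change G.Adj (![x0, x1, x2, x3, x4, x5, x6] i) (![x0, x1, x2, x3, x4, x5, x6] j) ↔ _
    fin_cases i <;> fin_cases j <;> simp [Xgraph, SimpleGraph.fromRel_adj, *, G.adj_comm] <;> (try rw [G.adj_comm]) <;> assumption

theorem mk_C6 {V : Type*} (G : SimpleGraph V) (c : V → Bool)
    (hc : ∀ u v, G.Adj u v → c u ≠ c v) (x0 x1 x2 u0 u1 u2 : V)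
    (h01 : G.Adj x0 u1) (h02 : G.Adj x0 u2) (h10 : G.Adj x1 u0) (h12 : G.Adj x1 u2)
    (h20 : G.Adj x2 u0) (h21 : G.Adj x2 u1) (n0 : ¬ G.Adj x0 u0) (n1 : ¬ G.Adj x1 u1)
    (n2 : ¬ G.Adj x2 u2) : Nonempty (SimpleGraph.cycleGraph 6 ↪g G) := by
  have hcol : ∀ u v, G.Adj u v → c v = !(c u) := by
    intro u v h
    have := hc u v h
    revert this
    cases c u <;> cases c v <;> simp
  have c1 := hcol _ _ h01
  have c2 := hcol _ _ h02
  have c3 := hcol _ _ h21.symm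
  have c4 := hcol _ _ h20
  have c5 := hcol _ _ h10.symm
  rw [c1] at c3
  rw [c3] at c4
  rw [c4] at c5
  simp only [Bool.not_not] at c1 c2 c3 c4 c5
  have D : ∀ u v w, G.Adj u w → ¬ G.Adj v w → u ≠ v := by
    rintro u v w h h' rfl; exact h' h
  refine cycle_of_ladder G c hc 2 le_rfl (c x0)
    (fun k => if k = 0 then x0 else if k = 1 then x2 else x1)
    (fun k => if k = 0 then u1 else if k = 1 then u2 else u0) ?_ ?_ ?_ ?_ ?_
  · intro k hk; interval_cases k <;> simp [*]
  · intro k hk; interval_cases k <;> simp [*]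
  · have e1 := D x0 x1 _ h01 n1
    have e2 := D x0 x2 _ h02 n2
    have e3 := D x1 x2 _ h12 n2
    intro k l hk hl; interval_cases k <;> interval_cases l <;> simp [*, Ne.symm]
  · have e1 := D u0 u1 _ h10.symm (fun h => n1 h.symm)
    have e2 := D u0 u2 _ h20.symm (fun h => n2 h.symm)
    have e3 := D u1 u2 _ h21.symm (fun h => n2 h.symm)
    intro k l hk hl; interval_cases k <;> interval_cases l <;> simp [*, Ne.symm]
  · intro k l hk hl; interval_cases k <;> interval_cases l <;> simp [*]

set_option maxHeartbeats 1000000 in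
theorem describable_vertex {V : Type*} [Fintype V] [Nonempty V] (G : SimpleGraph V)
    (hG : ChordalBipartite G) (hX : ¬ Nonempty (Xgraph ↪g G)) :
    ∃ (v : V) (D : Finset V), D.card ≤ 6 ∧ ((∀ x, G.Adj v x ↔ x ∈ D) ∨
      ∃ w, w ≠ v ∧ ∀ x, G.Adj v x ↔ ¬ (G.Adj w x ↔ x ∈ D)) := by
  classical
  obtain ⟨⟨C⟩, hcyc⟩ := hG
  let c : V → Bool := fun v => C v = 0
  have hc : ∀ u v, G.Adj u v → c u ≠ c v := by
    intro u v h h'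
    have h1 := C.valid h
    simp only [c, decide_eq_decide] at h'
    apply h1
    have : ∀ i j : Fin 2, (i = 0 ↔ j = 0) → i = j := by decide
    exact this _ _ h'
  obtain ⟨f, finj, hf⟩ := exists_order G
  obtain ⟨v, -, hvmin⟩ := (Finset.univ : Finset V).exists_min_image f Finset.univ_nonempty
  have chain : ∀ a a', G.Adj v a → G.Adj v a' → f a ≤ f a' → ∀ w, G.Adj a w → G.Adj a' w := by
    intro a a' h h' hle w hw
    by_cases hwv : w = v
    · subst hwv; exact h'.symm
    rcases hle.lt_or_eq with hlt | heq
    · exact gamma_free G c hc hcyc f hf v a a' w h h' hlt hw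
        (lt_of_le_of_ne (hvmin w (Finset.mem_univ _)) (fun h => hwv (finj h).symm))
    · rw [← finj heq]; exact hw
  by_cases hdeg : (G.neighborFinset v).card ≤ 2
  · exact ⟨v, G.neighborFinset v, by omega, Or.inl (fun x => by simp)⟩
  push Not at hdeg
  have twins : ∀ x y, x ≠ y → (∀ z, G.Adj x z ↔ G.Adj y z) → ∃ (v : V) (D : Finset V), D.card ≤ 6 ∧
      ((∀ x, G.Adj v x ↔ x ∈ D) ∨
      ∃ w, w ≠ v ∧ ∀ x, G.Adj v x ↔ ¬ (G.Adj w x ↔ x ∈ D)) := by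
    intro x y hxy h
    refine ⟨x, ∅, by simp, Or.inr ⟨y, hxy.symm, fun z => ?_⟩⟩
    simp [h z]
  -- the three smallest neighbours
  obtain ⟨a1, ha1, hm1⟩ := (G.neighborFinset v).exists_min_image f
    (Finset.card_pos.1 (by omega))
  have hc1 := Finset.card_erase_of_mem ha1
  obtain ⟨a2, ha2, hm2⟩ := ((G.neighborFinset v).erase a1).exists_min_image f
    (Finset.card_pos.1 (by omega))
  have hc2 := Finset.card_erase_of_mem ha2
  obtain ⟨a3, ha3, hm3⟩ := (((G.neighborFinset v).erase a1).erase a2).exists_min_image f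
    (Finset.card_pos.1 (by omega))
  simp only [Finset.mem_erase, mem_neighborFinset, and_imp] at ha1 ha2 ha3 hm1 hm2 hm3
  obtain ⟨d21, ha2⟩ := ha2
  obtain ⟨d32, d31, ha3⟩ := ha3
  have s12 := chain a1 a2 ha1 ha2 (hm1 _ ha2)
  have s23 := chain a2 a3 ha2 ha3 (hm2 _ d31 ha3)
  have s3 : ∀ a, G.Adj v a → a ≠ a1 → a ≠ a2 → ∀ w, G.Adj a3 w → G.Adj a w :=
    fun a h h1 h2 => chain a3 a ha3 h (hm3 a h2 h1 h)
  by_cases hb : ∃ b, G.Adj a1 b ∧ b ≠ v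
  swap
  · push Not at hb
    exact ⟨a1, {v}, by simp, Or.inl (fun x => by
      simp only [Finset.mem_singleton]
      exact ⟨hb x, fun h => h ▸ ha1.symm⟩)⟩
  obtain ⟨b, hb1, hbv⟩ := hb
  by_cases hw : ∃ w, G.Adj a3 w ∧ ¬ G.Adj a2 w
  swap
  · push Not at hw
    exact twins a2 a3 d32.symm (fun z => ⟨s23 z, hw z⟩)
  obtain ⟨w, hw3, hw2⟩ := hw
  have hwv : w ≠ v := by rintro rfl; exact hw2 ha2.symm
  have hvw_same : ¬ G.Adj a1 w := fun h => hw2 (s12 _ h)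
  let Dw : Finset V := G.neighborFinset w \ G.neighborFinset v
  have memD : ∀ x, x ∈ Dw ↔ G.Adj w x ∧ ¬ G.Adj v x := by intro x; simp [Dw]
  by_cases hDw : Dw.card ≤ 4
  · refine ⟨v, insert a1 (insert a2 Dw), ?_, Or.inr ⟨w, hwv, fun x => ?_⟩⟩
    · have h1 := Finset.card_insert_le a1 (insert a2 Dw)
      have h2 := Finset.card_insert_le a2 Dw
      omega
    · simp only [Finset.mem_insert, memD]
      by_cases e1 : x = a1
      · subst e1
        have : ¬ G.Adj w x := fun h => hvw_same h.symm
        simp [ha1, this]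
      by_cases e2 : x = a2
      · subst e2
        have : ¬ G.Adj w x := fun h => hw2 h.symm
        simp [ha2, this]
      have := fun h => (s3 x h e1 e2 w hw3).symm
      by_cases k1 : G.Adj v x
      · simp [e1, e2, k1, this k1]
      · by_cases k2 : G.Adj w x <;> simp [e1, e2, k1, k2]
  push Not at hDw
  -- every other neighbour of `a2` misses at most one vertex of `Dw`
  have miss : ∀ u, G.Adj a2 u → u ≠ v → ∀ p q, p ∈ Dw → q ∈ Dw → ¬ G.Adj u p → ¬ G.Adj u q →
      p = q := by
    intro u hu huv p q hp hq hup huq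
    by_contra hpq
    rw [memD] at hp hq
    exact hX (mk_X G c hc a3 u a2 v w p q (s23 u hu) hu.symm ha2.symm ha3 hw3 hp.1 hq.1 hw2
      hup huq hp.2 hq.2 huv hpq)
  let E : Finset V := Dw.filter fun x => G.Adj b x
  have hE : 4 ≤ E.card := by
    have h1 : (Dw.filter fun x => ¬ G.Adj b x).card ≤ 1 := by
      rw [Finset.card_le_one]
      intro p hp q hq
      rw [Finset.mem_filter] at hp hq
      exact miss b (s12 b hb1) hbv p q hp.1 hq.1 hp.2 hq.2
    have h2 := Finset.card_filter_add_card_filter_not (s := Dw) (fun x => G.Adj b x)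
    have h3 : E.card + (Dw.filter fun x => ¬ G.Adj b x).card = Dw.card := h2
    omega
  have nb : ∀ x ∈ E, ∀ z, G.Adj x z → z ≠ w → G.Adj a2 z := by
    intro x hx z hz hzw
    by_contra h2
    rw [Finset.mem_filter, memD] at hx
    have h1 : ¬ G.Adj a1 z := fun h => h2 (s12 _ h)
    exact hX (mk_X G c hc b a1 v a2 x z w hb1.symm ha1.symm ha2 (s12 b hb1) hx.2 hz hx.1.1.symm
      hx.1.2 h1 hvw_same h2 hw2 d21.symm hzw)
  let Full : V → Prop := fun x => ∀ u, G.Adj a2 u → u ≠ v → G.Adj x u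
  have full2 : ∀ x y, x ∈ E → y ∈ E → x ≠ y → Full x → Full y →
      ∃ (v : V) (D : Finset V), D.card ≤ 6 ∧
      ((∀ x, G.Adj v x ↔ x ∈ D) ∨
      ∃ w, w ≠ v ∧ ∀ x, G.Adj v x ↔ ¬ (G.Adj w x ↔ x ∈ D)) := by
    have aux : ∀ x y, x ∈ E → y ∈ E → Full y → ∀ z, G.Adj x z → G.Adj y z := by
      intro x y hx hy hfy z hz
      by_cases hzw : z = w
      · subst hzw
        rw [Finset.mem_filter, memD] at hy
        exact hy.1.1.symm
      · refine hfy z (nb x hx z hz hzw) ?_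
        rintro rfl
        rw [Finset.mem_filter, memD] at hx
        exact hx.1.2 hz.symm
    intro x y hx hy hxy hfx hfy
    exact twins x y hxy (fun z => ⟨aux x y hx hy hfy z, aux y x hy hx hfx z⟩)
  have three : ∀ x y z, x ∈ E → y ∈ E → z ∈ E → x ≠ y → x ≠ z → y ≠ z →
      Full x ∨ Full y ∨ Full z := by
    intro x y z hx hy hz hxy hxz hyz
    by_contra hcon
    simp only [Full, not_or, not_forall] at hcon
    obtain ⟨⟨u0, p0, q0, r0⟩, ⟨u1, p1, q1, r1⟩, ⟨u2, p2, q2, r2⟩⟩ := hcon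
    have hit : ∀ u x y, G.Adj a2 u → u ≠ v → x ∈ E → y ∈ E → x ≠ y → ¬ G.Adj x u → G.Adj y u := by
      intro u x y h1 h2 hx hy hxy h3
      by_contra h4
      exact hxy (miss u h1 h2 x y (Finset.mem_filter.1 hx).1 (Finset.mem_filter.1 hy).1
        (fun h => h3 h.symm) (fun h => h4 h.symm))
    exact hcyc 6 le_rfl (mk_C6 G c hc x y z u0 u1 u2
      (hit u1 y x p1 q1 hy hx hxy.symm r1) (hit u2 z x p2 q2 hz hx hxz.symm r2)
      (hit u0 x y p0 q0 hx hy hxy r0) (hit u2 z y p2 q2 hz hy hyz.symm r2)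
      (hit u0 x z p0 q0 hx hz hxz r0) (hit u1 y z p1 q1 hy hz hyz r1) r0 r1 r2)
  obtain ⟨E', hE', hcard⟩ := Finset.exists_subset_card_eq hE
  obtain ⟨x0, x1, x2, x3, h01, h02, h03, h12, h13, h23, rfl⟩ := Finset.card_eq_four.1 hcard
  have m0 : x0 ∈ E := hE' (by simp)
  have m1 : x1 ∈ E := hE' (by simp)
  have m2 : x2 ∈ E := hE' (by simp)
  have m3 : x3 ∈ E := hE' (by simp)
  rcases three x0 x1 x2 m0 m1 m2 h01 h02 h12 with h | h | h
  · rcases three x1 x2 x3 m1 m2 m3 h12 h13 h23 with hh | hh | hh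
    · exact full2 x0 x1 m0 m1 h01 h hh
    · exact full2 x0 x2 m0 m2 h02 h hh
    · exact full2 x0 x3 m0 m3 h03 h hh
  · rcases three x0 x2 x3 m0 m2 m3 h02 h03 h23 with hh | hh | hh
    · exact full2 x0 x1 m0 m1 h01 hh h
    · exact full2 x1 x2 m1 m2 h12 h hh
    · exact full2 x1 x3 m1 m3 h13 h hh
  · rcases three x0 x1 x3 m0 m1 m3 h01 h03 h13 with hh | hh | hh
    · exact full2 x0 x2 m0 m2 h02 hh h
    · exact full2 x1 x2 m1 m2 h12 hh h
    · exact full2 x2 x3 m2 m3 h23 h hh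

/-- Replace the neighbourhood of `v` in `H` by the one described by `w` and `d`. -/
def attachVertex {V : Type*} (H : SimpleGraph V) (v : V) (w : Option V) (d : Fin 6 → Option V) :
    SimpleGraph V :=
  let N : V → Prop := fun y => ¬ ((∃ w', w = some w' ∧ H.Adj w' y) ↔ ∃ i, d i = some y)
  SimpleGraph.fromRel fun x y => (x ≠ v ∧ y ≠ v ∧ H.Adj x y) ∨ (x = v ∧ N y)

/-- Decode a list of vertex descriptions. -/
def decodeGraph {V : Type*} : List (V × Option V × (Fin 6 → Option V)) → SimpleGraph V
  | [] => ⊥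
  | t :: L => attachVertex (decodeGraph L) t.1 t.2.1 t.2.2

theorem exists_code {V : Type*} [Fintype V] (G : SimpleGraph V)
    (hG : ChordalBipartite G) (hX : ¬ Nonempty (Xgraph ↪g G)) (k : ℕ) :
    ∀ S : Finset V, S.card = k → ∃ L : List (V × Option V × (Fin 6 → Option V)), L.length = k ∧
      ∀ x ∈ S, ∀ y ∈ S, (G.Adj x y ↔ (decodeGraph L).Adj x y) := by
  classical
  induction k with
  | zero =>
    intro S hS
    rw [Finset.card_eq_zero] at hS
    subst hS
    exact ⟨[], rfl, by simp⟩
  | succ k ih =>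
    intro S hS
    let e : G.induce (S : Set V) ↪g G := SimpleGraph.Embedding.induce _
    have : Nonempty (S : Set V) := by
      obtain ⟨x, hx⟩ := Finset.card_pos.1 (by omega : 0 < S.card)
      exact ⟨⟨x, hx⟩⟩
    obtain ⟨v, D, hD, h⟩ := describable_vertex (G.induce (S : Set V))
      ⟨hG.1.of_hom e.toHom, fun m hm ⟨g⟩ => hG.2 m hm ⟨e.comp g⟩⟩ (fun ⟨g⟩ => hX ⟨e.comp g⟩)
    obtain ⟨L, hL, hLS⟩ := ih (S.erase v.1) (by rw [Finset.card_erase_of_mem v.2]; omega)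
    let d : Fin 6 → Option V := fun i => (D.toList[i.val]?).map Subtype.val
    have hd : ∀ y : (S : Set V), (∃ i, d i = some y.1) ↔ y ∈ D := by
      intro y
      rw [← Finset.mem_toList, List.mem_iff_getElem?]
      constructor
      · rintro ⟨i, hi⟩
        simp only [d, Option.map_eq_some_iff] at hi
        obtain ⟨z, hz, hzy⟩ := hi
        exact ⟨i.val, by rw [hz, Subtype.ext hzy]⟩
      · rintro ⟨i, hi⟩
        have : i < D.toList.length := by
          by_contra hcon
          rw [List.getElem?_eq_none (by omega)] at hi
          simp at hi
        rw [Finset.length_toList] at this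
        exact ⟨⟨i, by omega⟩, by simp [d, hi]⟩
    have hw : ∃ w : Option V, ∀ y ∈ S, y ≠ v.1 → (G.Adj v.1 y ↔
        ¬ ((∃ w', w = some w' ∧ (decodeGraph L).Adj w' y) ↔ ∃ i, d i = some y)) := by
      rcases h with h | ⟨w, hwv, h⟩
      · refine ⟨none, fun y hy hyv => ?_⟩
        have h1 := h ⟨y, hy⟩
        have h2 := hd ⟨y, hy⟩
        simp only [SimpleGraph.comap_adj, Function.Embedding.subtype_apply] at h1
        rw [h2, h1]
        simp
      · refine ⟨some w.1, fun y hy hyv => ?_⟩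
        have h1 := h ⟨y, hy⟩
        have h2 := hd ⟨y, hy⟩
        have h3 := hLS w.1 (Finset.mem_erase.2 ⟨fun h => hwv (Subtype.ext h), w.2⟩) y
          (Finset.mem_erase.2 ⟨hyv, hy⟩)
        simp only [SimpleGraph.comap_adj, Function.Embedding.subtype_apply] at h1
        rw [h2, h1, h3]
        simp
    obtain ⟨w, hw⟩ := hw
    refine ⟨(v.1, w, d) :: L, by simp [hL], ?_⟩
    have gen : ∀ x y, (decodeGraph ((v.1, w, d) :: L)).Adj x y ↔ x ≠ y ∧
        (((x ≠ v.1 ∧ y ≠ v.1 ∧ (decodeGraph L).Adj x y) ∨ (x = v.1 ∧ 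
          ¬ ((∃ w', w = some w' ∧ (decodeGraph L).Adj w' y) ↔ ∃ i, d i = some y))) ∨
        ((y ≠ v.1 ∧ x ≠ v.1 ∧ (decodeGraph L).Adj y x) ∨ (y = v.1 ∧ 
          ¬ ((∃ w', w = some w' ∧ (decodeGraph L).Adj w' x) ↔ ∃ i, d i = some x)))) := by
      intro x y
      rfl
    intro x hx y hy
    rw [gen]
    by_cases hxy : x = y
    · subst hxy; simp
    by_cases hxv : x = v.1
    · have hyv : y ≠ v.1 := fun h => hxy (hxv.trans h.symm)
      have := hw y hy hyv
      subst hxv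
      rw [this]
      simp [hxy, hyv]
    · by_cases hyv : y = v.1
      · have := hw x hx hxv
        subst hyv
        rw [G.adj_comm, this]
        simp [hxy]
      · have := hLS x (Finset.mem_erase.2 ⟨hxv, hx⟩) y (Finset.mem_erase.2 ⟨hyv, hy⟩)
        rw [this]
        simp [hxy, hxv, hyv, (decodeGraph L).adj_comm y x]

theorem upper_bound (n : ℕ) (hn : 2 ≤ n) :
    Nat.card {G : SimpleGraph (Fin n) // ChordalBipartite G ∧ ¬ Nonempty (Xgraph ↪g G)} ≤
      n ^ (16 * n) := by
  classical
  let T := Fin n × Option (Fin n) × (Fin 6 → Option (Fin n))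
  have key : ∀ G : {G : SimpleGraph (Fin n) // ChordalBipartite G ∧ ¬ Nonempty (Xgraph ↪g G)},
      ∃ L : List.Vector T n, decodeGraph L.1 = G.1 := by
    intro G
    obtain ⟨L, hL, h⟩ := exists_code G.1 G.2.1 G.2.2 n Finset.univ (by simp)
    refine ⟨⟨L, hL⟩, ?_⟩
    ext x y
    exact (h x (Finset.mem_univ _) y (Finset.mem_univ _)).symm
  choose F hF using key
  have hinj : Function.Injective F := by
    intro G G' h
    apply Subtype.ext
    rw [← hF G, ← hF G', h]
  have h1 := Nat.card_le_card_of_injective F hinj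
  have h2 : Nat.card (List.Vector T n) = (n * ((n + 1) * (n + 1) ^ 6)) ^ n := by
    rw [Nat.card_eq_fintype_card, card_vector]
    simp [T]
  have h3 : n + 1 ≤ n ^ 2 := by nlinarith
  calc _ ≤ _ := h1
    _ = (n * ((n + 1) * (n + 1) ^ 6)) ^ n := h2
    _ ≤ (n * (n ^ 2 * (n ^ 2) ^ 6)) ^ n := by gcongr
    _ = n ^ (15 * n) := by rw [pow_mul]; congr 1; ring
    _ ≤ n ^ (16 * n) := Nat.pow_le_pow_right (by omega) (by omega)

/-- The star forest given by a map. -/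
def starForest (n h : ℕ) (g : Fin h → Fin h) : SimpleGraph (Fin n) :=
  SimpleGraph.fromRel fun x y => ∃ i : Fin h, x.val = h + i.val ∧ y.val = (g i).val

theorem starForest_adj (n h : ℕ) (g : Fin h → Fin h) (x y : Fin n) (hx : h ≤ x.val) :
    (starForest n h g).Adj x y ↔ ∃ i : Fin h, x.val = h + i.val ∧ y.val = (g i).val := by
  simp only [starForest, SimpleGraph.fromRel_adj]
  constructor
  · rintro ⟨-, h1 | ⟨i, h1, h2⟩⟩
    · exact h1
    · have := (g i).2; omega
  · rintro ⟨i, h1, h2⟩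
    refine ⟨?_, Or.inl ⟨i, h1, h2⟩⟩
    rintro rfl
    have := (g i).2
    omega

theorem starForest_edge (n h : ℕ) (g : Fin h → Fin h) (x y : Fin n)
    (hxy : (starForest n h g).Adj x y) : (h ≤ x.val ∧ y.val < h) ∨ (h ≤ y.val ∧ x.val < h) := by
  simp only [starForest, SimpleGraph.fromRel_adj] at hxy
  obtain ⟨-, ⟨i, h1, h2⟩ | ⟨i, h1, h2⟩⟩ := hxy
  · have := (g i).2; omega
  · have := (g i).2; omega

theorem starForest_no_cycle (n h : ℕ) (g : Fin h → Fin h) (p q r s : Fin n)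
    (hpq : (starForest n h g).Adj p q) (hqr : (starForest n h g).Adj q r)
    (hrs : (starForest n h g).Adj r s) (hpr : p ≠ r) (hqs : q ≠ s) : False := by
  have deg : ∀ x y z, h ≤ x.val → (starForest n h g).Adj x y → (starForest n h g).Adj x z →
      y = z := by
    intro x y z hx hy hz
    rw [starForest_adj _ _ _ _ _ hx] at hy hz
    obtain ⟨i, h1, h2⟩ := hy
    obtain ⟨j, h3, h4⟩ := hz
    have : i = j := Fin.ext (by omega)
    subst this
    exact Fin.ext (by omega)
  rcases starForest_edge n h g q r hqr with h1 | h1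
  · exact hpr (deg q p r h1.1 hpq.symm hqr)
  · exact hqs (deg r q s h1.1 hqr.symm hrs)

theorem starForest_mem (n h : ℕ) (g : Fin h → Fin h) :
    ChordalBipartite (starForest n h g) ∧ ¬ Nonempty (Xgraph ↪g starForest n h g) := by
  refine ⟨⟨?_, ?_⟩, ?_⟩
  · refine ⟨SimpleGraph.Coloring.mk (fun x => if x.val < h then (0 : Fin 2) else 1) ?_⟩
    intro x y hxy
    rcases starForest_edge n h g x y hxy with h1 | h1
    · simp [h1.2, not_lt.2 h1.1]
    · simp [h1.2, not_lt.2 h1.1]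
  · rintro m hm ⟨e⟩
    obtain ⟨k, rfl⟩ : ∃ k, m = k + 6 := ⟨m - 6, by omega⟩
    have ad : ∀ i (hi : i + 1 < k + 6), (SimpleGraph.cycleGraph (k+6)).Adj ⟨i, by omega⟩ ⟨i+1, hi⟩ := by
      intro i hi
      rw [SimpleGraph.cycleGraph_adj']
      right
      rw [Fin.sub_def]
      simp only
      rw [show k + 6 - i + (i + 1) = 1 + (k + 6) by omega, Nat.add_mod_right, Nat.mod_eq_of_lt (by omega)]
    refine starForest_no_cycle n h g (e ⟨0, by omega⟩) (e ⟨1, by omega⟩) (e ⟨2, by omega⟩)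
      (e ⟨3, by omega⟩) (e.map_rel_iff.2 (ad 0 (by omega))) (e.map_rel_iff.2 (ad 1 (by omega)))
      (e.map_rel_iff.2 (ad 2 (by omega))) ?_ ?_
    · intro h; have := e.injective h; simp at this
    · intro h; have := e.injective h; simp at this
  · rintro ⟨e⟩
    refine starForest_no_cycle n h g (e 0) (e 1) (e 2) (e 3) (e.map_rel_iff.2 ?_)
      (e.map_rel_iff.2 ?_) (e.map_rel_iff.2 ?_) ?_ ?_
    · simp [Xgraph]
    · simp [Xgraph]
    · simp [Xgraph]
    · intro h; have := e.injective h; simp at this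
    · intro h; have := e.injective h; simp at this

theorem lower_bound (n h : ℕ) (hn : 2 * h ≤ n) :
    h ^ h ≤
    Nat.card {G : SimpleGraph (Fin n) // ChordalBipartite G ∧ ¬ Nonempty (Xgraph ↪g G)} := by
  classical
  let F : (Fin h → Fin h) →
      {G : SimpleGraph (Fin n) // ChordalBipartite G ∧ ¬ Nonempty (Xgraph ↪g G)} :=
    fun g => ⟨starForest n h g, starForest_mem n h g⟩
  have hF : Function.Injective F := by
    intro g g' hgg
    have h0 : starForest n h g = starForest n h g' := congrArg Subtype.val hgg
    funext i
    have hx : (starForest n h g).Adj ⟨h + i.val, by omega⟩ ⟨(g i).val, by omega⟩ := by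
      rw [starForest_adj _ _ _ _ _ (by simp)]
      exact ⟨i, rfl, rfl⟩
    rw [h0, starForest_adj _ _ _ _ _ (by simp)] at hx
    obtain ⟨j, h1, h2⟩ := hx
    simp only at h1 h2
    have : i = j := Fin.ext (by omega)
    subst this
    exact Fin.ext h2
  have := Nat.card_le_card_of_injective F hF
  simpa using this

/-- The class of `X`-free chordal bipartite graphs is factorial: for all large `n`, the
number of labelled `X`-free chordal bipartite graphs on `{1, …, n}` is between
`n^(c₁·n)` and `n^(c₂·n)`. -/
theorem statement15 :
    ∃ c₁ c₂ : ℝ, 0 < c₁ ∧ 0 < c₂ ∧ ∃ N : ℕ, ∀ n : ℕ, N ≤ n →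
      (n : ℝ) ^ (c₁ * n) ≤
        (Nat.card {G : SimpleGraph (Fin n) //
          ChordalBipartite G ∧ ¬ Nonempty (Xgraph ↪g G)} : ℝ) ∧
      (Nat.card {G : SimpleGraph (Fin n) //
          ChordalBipartite G ∧ ¬ Nonempty (Xgraph ↪g G)} : ℝ) ≤ (n : ℝ) ^ (c₂ * n) := by
  refine ⟨1 / 8, 16, by norm_num, by norm_num, 16, fun n hn => ⟨?_, ?_⟩⟩
  · have h1 := lower_bound n (n / 2) (by omega)
    have hpos : (1 : ℝ) ≤ n := by exact_mod_cast (by omega : 1 ≤ n)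
    have hsq : n ≤ (n / 2) ^ 2 := by
      have : n ≤ 2 * (n / 2) + 1 := by omega
      have : 8 ≤ n / 2 := by omega
      nlinarith
    have hsqR : (n : ℝ) ≤ ((n / 2 : ℕ) : ℝ) ^ 2 := by exact_mod_cast hsq
    have hq : (n : ℝ) / 4 ≤ ((n / 2 : ℕ) : ℝ) := by
      have : n ≤ 4 * (n / 2) := by omega
      have : (n : ℝ) ≤ 4 * ((n / 2 : ℕ) : ℝ) := by exact_mod_cast this
      linarith
    have hh : (0 : ℝ) ≤ ((n / 2 : ℕ) : ℝ) := by positivity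
    calc (n : ℝ) ^ (1 / 8 * (n : ℝ)) ≤ (n : ℝ) ^ (((n / 2 : ℕ) : ℝ) / 2) :=
          Real.rpow_le_rpow_of_exponent_le hpos (by linarith)
      _ ≤ (((n / 2 : ℕ) : ℝ) ^ 2) ^ (((n / 2 : ℕ) : ℝ) / 2) :=
          Real.rpow_le_rpow (by positivity) hsqR (by positivity)
      _ = ((n / 2 : ℕ) : ℝ) ^ (n / 2 : ℕ) := by
          rw [← Real.rpow_natCast _ 2, ← Real.rpow_mul hh, ← Real.rpow_natCast _ (n / 2)]
          congr 1
          push_cast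
          ring
      _ ≤ _ := by exact_mod_cast h1
  · have h1 := upper_bound n (by omega)
    have e : (n : ℝ) ^ ((16 : ℝ) * n) = ((n ^ (16 * n) : ℕ) : ℝ) := by
      rw [show (16 : ℝ) * n = ((16 * n : ℕ) : ℝ) by push_cast; ring, Real.rpow_natCast]
      push_cast
      rfl
    rw [e]
    exact_mod_cast h1
end

section
/- Let Y be the 7-vertex graph that is the disjoint union of a 4-cycle C₄ and a path P₃ on three vertices. Then the class of Y-free chordal bipartite graphs is factorial: there exist constants c₁, c₂ > 0 and N such that for every n ≥ N, the number of simple graphs on the labeled vertex set {1, …, n} that are chordal bipartite and Y-free is at least n^(c₁·n) and at most n^(c₂·n). -/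
open SimpleGraph

/-- The graph `Y`: the disjoint union of a 4-cycle `0-1-2-3-0` and a path `4-5-6`. -/
def Ygraph : SimpleGraph (Fin 7) :=
  SimpleGraph.fromRel fun i j =>
    ((i : ℕ), (j : ℕ)) ∈ [(0,1),(1,2),(2,3),(3,0),(4,5),(5,6)]

/-! ### Part A: near half-graphs -/

/-- At most one element of `[lo, hi)` satisfies `P`. -/
def AMO (P : ℕ → Prop) (lo hi : ℕ) : Prop :=
  ∀ a b, lo ≤ a → a < hi → lo ≤ b → b < hi → P a → P b → a = b

lemma AMO.mono {P : ℕ → Prop} {lo hi lo' hi' : ℕ} (h : AMO P lo hi) (h1 : lo ≤ lo')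
    (h2 : hi' ≤ hi) : AMO P lo' hi' := fun a b ha ha' hb hb' pa pb =>
  h a b (by omega) (by omega) (by omega) (by omega) pa pb

lemma amo_false (lo hi : ℕ) : AMO (fun _ => False) lo hi := fun _ _ _ _ _ _ h => h.elim

lemma AMO.card_le {P : ℕ → Prop} [DecidablePred P] {lo hi : ℕ} (h : AMO P lo hi) :
    ((Finset.Ico lo hi).filter P).card ≤ 1 := by
  rw [Finset.card_le_one]
  intro a ha b hb
  simp only [Finset.mem_filter, Finset.mem_Ico] at ha hb
  exact h a b ha.1.1 ha.1.2 hb.1.1 hb.1.2 ha.2 hb.2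

open Classical in
lemma pick2 (lo : ℕ) {P1 P2 P3 P4 : ℕ → Prop} (h1 : AMO P1 lo (lo + 6)) (h2 : AMO P2 lo (lo + 6))
    (h3 : AMO P3 lo (lo + 6)) (h4 : AMO P4 lo (lo + 6)) :
    ∃ e f, lo ≤ e ∧ e < lo + 6 ∧ lo ≤ f ∧ f < lo + 6 ∧ e ≠ f ∧
      (¬ P1 e ∧ ¬ P2 e ∧ ¬ P3 e ∧ ¬ P4 e) ∧ (¬ P1 f ∧ ¬ P2 f ∧ ¬ P3 f ∧ ¬ P4 f) := by
  set I := Finset.Ico lo (lo + 6) with hI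
  have hc : I.card = 6 := by simp [hI]
  have hb : (I.filter P1 ∪ I.filter P2 ∪ I.filter P3 ∪ I.filter P4).card ≤ 4 := by
    have e1 : (I.filter P1).card ≤ 1 := h1.card_le
    have e2 : (I.filter P2).card ≤ 1 := h2.card_le
    have e3 : (I.filter P3).card ≤ 1 := h3.card_le
    have e4 : (I.filter P4).card ≤ 1 := h4.card_le
    have := Finset.card_union_le (I.filter P1 ∪ I.filter P2 ∪ I.filter P3) (I.filter P4)
    have := Finset.card_union_le (I.filter P1 ∪ I.filter P2) (I.filter P3)
    have := Finset.card_union_le (I.filter P1) (I.filter P2)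
    omega
  have hg : 1 < (I \ (I.filter P1 ∪ I.filter P2 ∪ I.filter P3 ∪ I.filter P4)).card := by
    have := Finset.le_card_sdiff (I.filter P1 ∪ I.filter P2 ∪ I.filter P3 ∪ I.filter P4) I
    omega
  obtain ⟨e, he, f, hf, hef⟩ := Finset.one_lt_card.1 hg
  simp only [hI, Finset.mem_sdiff, Finset.mem_union, Finset.mem_filter, Finset.mem_Ico, not_or,
    not_and] at he hf
  obtain ⟨he, ⟨⟨a1, a2⟩, a3⟩, a4⟩ := he
  obtain ⟨hf, ⟨⟨b1, b2⟩, b3⟩, b4⟩ := hf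
  exact ⟨e, f, he.1, he.2, hf.1, hf.2, hef, ⟨a1 he, a2 he, a3 he, a4 he⟩,
    b1 hf, b2 hf, b3 hf, b4 hf⟩

section NearHalf

variable {R C : Type*}

/-- Matrix form of the exclusion of `Y` (path centred at a row). -/
def YF (M : R → C → Prop) : Prop :=
  ∀ r1 r2 c1 c2 w d d', r1 ≠ r2 → c1 ≠ c2 → M r1 c1 → M r1 c2 → M r2 c1 → M r2 c2 →
    d ≠ d' → M w d → M w d' → ¬ M w c1 → ¬ M w c2 → ¬ M r1 d → ¬ M r1 d' → ¬ M r2 d →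
    ¬ M r2 d' → False

/-- A near half-graph of length `k`. -/
structure NH (M : R → C → Prop) (k : ℕ) (x : ℕ → R) (y : ℕ → C) : Prop where
  xinj : ∀ i < k, ∀ j < k, x i = x j → i = j
  yinj : ∀ i < k, ∀ j < k, y i = y j → i = j
  near : ∀ i < k, ∀ j < k, i < j + 18 → j < i + 18 → (M (x i) (y j) ↔ i ≤ j)
  e1 : ∀ j < k, AMO (fun i => ¬ M (x i) (y j)) 0 (j + 1)
  e2 : ∀ j < k, AMO (fun i => M (x i) (y j)) (j + 1) k
  e3 : ∀ i < k, AMO (fun j => ¬ M (x i) (y j)) i k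
  e4 : ∀ i < k, AMO (fun j => M (x i) (y j)) 0 i

/-- Threshold of a column. -/
def ThC (M : R → C → Prop) (k : ℕ) (x : ℕ → R) (d : C) (t : ℕ) : Prop :=
  t ≤ k ∧ AMO (fun i => ¬ M (x i) d) 0 t ∧ AMO (fun i => M (x i) d) (t + 6) k

/-- Threshold of a row. -/
def ThR (M : R → C → Prop) (k : ℕ) (y : ℕ → C) (r : R) (s : ℕ) : Prop :=
  s ≤ k ∧ AMO (fun j => M r (y j)) 0 s ∧ AMO (fun j => ¬ M r (y j)) (s + 6) k

variable {M : R → C → Prop} {k : ℕ} {x : ℕ → R} {y : ℕ → C}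

lemma NH.thC (H : NH M k x y) {j : ℕ} (hj : j < k) : ThC M k x (y j) j :=
  ⟨hj.le, (H.e1 j hj).mono le_rfl (by omega), (H.e2 j hj).mono (by omega) le_rfl⟩

lemma NH.thR (H : NH M k x y) {i : ℕ} (hi : i < k) : ThR M k y (x i) i :=
  ⟨hi.le, (H.e4 i hi), (H.e3 i hi).mono (by omega) le_rfl⟩

/-- either at most one, or a second smallest element -/
lemma second_smallest (P : ℕ → Prop) (k : ℕ) :
    AMO P 0 k ∨ ∃ a b, a < b ∧ b < k ∧ P a ∧ P b ∧ AMO P 0 b := by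
  classical
  by_cases h : AMO P 0 k
  · exact Or.inl h
  right
  have hex : ∃ b, b < k ∧ P b ∧ ∃ a < b, P a := by
    unfold AMO at h
    push Not at h
    obtain ⟨a, b, -, ha, -, hb, pa, pb, hab⟩ := h
    rcases lt_or_gt_of_ne hab with h | h
    · exact ⟨b, hb, pb, a, h, pa⟩
    · exact ⟨a, ha, pa, b, h, pb⟩
  obtain ⟨hb, pb, a, hab, pa⟩ := Nat.find_spec hex
  refine ⟨a, Nat.find hex, hab, hb, pa, pb, ?_⟩
  intro u v _ hu _ hv pu pv
  by_contra huv
  rcases lt_or_gt_of_ne huv with h | h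
  · exact Nat.find_min hex hv ⟨by omega, pv, u, h, pu⟩
  · exact Nat.find_min hex hu ⟨by omega, pu, v, h, pv⟩

lemma NH.exists_thC (Y2 : YF (fun c r => M r c)) (H : NH M k x y) (d : C) : ∃ t, ThC M k x d t := by
  rcases second_smallest (fun i => ¬ M (x i) d) k with h | ⟨a, b, hab, hb, pa, pb, h⟩
  · exact ⟨k, le_rfl, h, fun _ _ _ _ _ _ => by omega⟩
  refine ⟨b, hb.le, h, ?_⟩
  intro i i' hi hik hi' hik' mi mi'
  by_contra hii
  obtain ⟨e, f, he, he', hf, hf', hef, ⟨p1, p2, p3, p4⟩, q1, q2, q3, q4⟩ :=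
    pick2 b ((H.e3 a (by omega)).mono hab.le (by omega : b + 6 ≤ k))
      ((H.e3 b (by omega)).mono le_rfl (by omega : b + 6 ≤ k))
      ((H.e4 i hik).mono (by omega : 0 ≤ b) (by omega : b + 6 ≤ i))
      ((H.e4 i' hik').mono (by omega : 0 ≤ b) (by omega : b + 6 ≤ i'))
  simp only [not_not] at p1 p2 q1 q2
  exact Y2 (y e) (y f) (x a) (x b) d (x i) (x i')
    (fun h => hef (H.yinj _ (by omega) _ (by omega) h))
    (fun h => by have := H.xinj _ (by omega) _ (by omega) h; omega)
    p1 p2 q1 q2 (fun h => hii (H.xinj _ hik _ hik' h)) mi mi' pa pb p3 p4 q3 q4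

lemma NH.exists_thR (Y1 : YF M) (H : NH M k x y) (r : R) : ∃ t, ThR M k y r t := by
  rcases second_smallest (fun j => M r (y j)) k with h | ⟨a, b, hab, hb, pa, pb, h⟩
  · exact ⟨k, le_rfl, h, fun _ _ _ _ _ _ => by omega⟩
  refine ⟨b, hb.le, h, ?_⟩
  intro i i' hi hik hi' hik' mi mi'
  by_contra hii
  obtain ⟨e, f, he, he', hf, hf', hef, ⟨p1, p2, p3, p4⟩, q1, q2, q3, q4⟩ :=
    pick2 (b + 1) ((H.e1 i hik).mono (by omega : 0 ≤ b + 1) (by omega : b + 1 + 6 ≤ i + 1))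
      ((H.e1 i' hik').mono (by omega : 0 ≤ b + 1) (by omega : b + 1 + 6 ≤ i' + 1))
      ((H.e2 a (by omega)).mono (by omega : a + 1 ≤ b + 1) (by omega : b + 1 + 6 ≤ k))
      ((H.e2 b (by omega)).mono (by omega : b + 1 ≤ b + 1) (by omega : b + 1 + 6 ≤ k))
  simp only [not_not] at p1 p2 q1 q2
  exact Y1 (x e) (x f) (y i) (y i') r (y a) (y b)
    (fun h => hef (H.xinj _ (by omega) _ (by omega) h))
    (fun h => by have := H.yinj _ (by omega) _ (by omega) h; omega)
    p1 p2 q1 q2 (fun h => by have := H.yinj _ (by omega) _ (by omega) h; omega)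
    pa pb mi mi' p3 p4 q3 q4

/-- a column misses at most one much smaller row -/
lemma NH.f1 (Y2 : YF (fun c r => M r c)) (H : NH M k x y) {d : C} {t : ℕ} (hd : ThC M k x d t) {r r' : R} {s s' : ℕ}
    (hr : ThR M k y r s) (hr' : ThR M k y r' s') (h : s + 18 ≤ t) (h' : s' + 18 ≤ t)
    (hn : r ≠ r') : M r d ∨ M r' d := by
  by_contra hc
  push Not at hc
  obtain ⟨hdk, d1, d2⟩ := hd
  obtain ⟨-, r1, r2⟩ := hr
  obtain ⟨-, r1', r2'⟩ := hr'
  obtain ⟨T, hT, hT', hTt⟩ : ∃ T, s ≤ T ∧ s' ≤ T ∧ T + 18 ≤ t := ⟨max s s', by omega, by omega, by omega⟩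
  obtain ⟨e, f, he, he', hf, hf', hef, ⟨p1, p2, -, -⟩, q1, q2, -, -⟩ :=
    pick2 (T + 6) (r2.mono (by omega : s + 6 ≤ T + 6) (by omega : T + 6 + 6 ≤ k))
      (r2'.mono (by omega : s' + 6 ≤ T + 6) (by omega : T + 6 + 6 ≤ k))
      (amo_false _ _) (amo_false _ _)
  obtain ⟨a, b, ha, ha', hb, hb', hab, ⟨u1, u2, u3, -⟩, v1, v2, v3, -⟩ :=
    pick2 (T + 12) (d1.mono (by omega : 0 ≤ T + 12) (by omega : T + 12 + 6 ≤ t))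
      ((H.e2 e (by omega)).mono (by omega : e + 1 ≤ T + 12) (by omega : T + 12 + 6 ≤ k))
      ((H.e2 f (by omega)).mono (by omega : f + 1 ≤ T + 12) (by omega : T + 12 + 6 ≤ k))
      (amo_false _ _)
  simp only [not_not] at p1 p2 q1 q2 u1 v1
  exact Y2 (y e) (y f) r r' d (x a) (x b)
    (fun h => hef (H.yinj _ (by omega) _ (by omega) h)) hn p1 p2 q1 q2
    (fun h => hab (H.xinj _ (by omega) _ (by omega) h)) u1 v1 hc.1 hc.2 u2 v2 u3 v3

/-- a column contains at most one much larger row -/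
lemma NH.f2 (Y2 : YF (fun c r => M r c)) (H : NH M k x y) {d : C} {t : ℕ} (hd : ThC M k x d t) {r r' : R} {s s' : ℕ}
    (hr : ThR M k y r s) (hr' : ThR M k y r' s') (h : t + 18 ≤ s) (h' : t + 18 ≤ s')
    (hn : r ≠ r') (m : M r d) (m' : M r' d) : False := by
  obtain ⟨hdk, d1, d2⟩ := hd
  obtain ⟨hk1, r1, r2⟩ := hr
  obtain ⟨hk2, r1', r2'⟩ := hr'
  obtain ⟨a, b, ha, ha', hb, hb', hab, ⟨u1, -, -, -⟩, v1, -, -, -⟩ :=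
    pick2 (t + 6) (d2.mono (by omega : t + 6 ≤ t + 6) (by omega : t + 6 + 6 ≤ k))
      (amo_false _ _) (amo_false _ _) (amo_false _ _)
  obtain ⟨e, f, he, he', hf, hf', hef, ⟨p1, p2, p3, p4⟩, q1, q2, q3, q4⟩ :=
    pick2 (t + 12) (r1.mono (by omega : 0 ≤ t + 12) (by omega : t + 12 + 6 ≤ s))
      (r1'.mono (by omega : 0 ≤ t + 12) (by omega : t + 12 + 6 ≤ s'))
      ((H.e3 a (by omega)).mono (by omega : a ≤ t + 12) (by omega : t + 12 + 6 ≤ k))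
      ((H.e3 b (by omega)).mono (by omega : b ≤ t + 12) (by omega : t + 12 + 6 ≤ k))
  simp only [not_not] at p3 p4 q3 q4
  exact Y2 (y e) (y f) (x a) (x b) d r r'
    (fun h => hef (H.yinj _ (by omega) _ (by omega) h))
    (fun h => hab (H.xinj _ (by omega) _ (by omega) h))
    p3 p4 q3 q4 hn m m' u1 v1 p1 p2 q1 q2

/-- a row misses at most one much larger column -/
lemma NH.f3 (Y1 : YF M) (H : NH M k x y) {r : R} {s : ℕ} (hr : ThR M k y r s) {d d' : C} {t t' : ℕ}
    (hd : ThC M k x d t) (hd' : ThC M k x d' t') (h : s + 18 ≤ t) (h' : s + 18 ≤ t')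
    (hn : d ≠ d') : M r d ∨ M r d' := by
  by_contra hc
  push Not at hc
  obtain ⟨hdk, d1, d2⟩ := hd
  obtain ⟨hdk', d1', d2'⟩ := hd'
  obtain ⟨hk1, r1, r2⟩ := hr
  obtain ⟨e, f, he, he', hf, hf', hef, ⟨p1, -, -, -⟩, q1, -, -, -⟩ :=
    pick2 (s + 6) (r2.mono (by omega : s + 6 ≤ s + 6) (by omega : s + 6 + 6 ≤ k))
      (amo_false _ _) (amo_false _ _) (amo_false _ _)
  obtain ⟨a, b, ha, ha', hb, hb', hab, ⟨u1, u2, u3, u4⟩, v1, v2, v3, v4⟩ :=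
    pick2 (s + 12) (d1.mono (by omega : 0 ≤ s + 12) (by omega : s + 12 + 6 ≤ t))
      (d1'.mono (by omega : 0 ≤ s + 12) (by omega : s + 12 + 6 ≤ t'))
      ((H.e2 e (by omega)).mono (by omega : e + 1 ≤ s + 12) (by omega : s + 12 + 6 ≤ k))
      ((H.e2 f (by omega)).mono (by omega : f + 1 ≤ s + 12) (by omega : s + 12 + 6 ≤ k))
  simp only [not_not] at p1 q1 u1 v1 u2 v2
  exact Y1 (x a) (x b) d d' r (y e) (y f)
    (fun h => hab (H.xinj _ (by omega) _ (by omega) h)) hn u1 u2 v1 v2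
    (fun h => hef (H.yinj _ (by omega) _ (by omega) h)) p1 q1 hc.1 hc.2 u3 u4 v3 v4

/-- a row contains at most one much smaller column -/
lemma NH.f4 (Y1 : YF M) (H : NH M k x y) {r : R} {s : ℕ} (hr : ThR M k y r s) {d d' : C} {t t' : ℕ}
    (hd : ThC M k x d t) (hd' : ThC M k x d' t') (h : t + 18 ≤ s) (h' : t' + 18 ≤ s)
    (hn : d ≠ d') (m : M r d) (m' : M r d') : False := by
  obtain ⟨hdk, d1, d2⟩ := hd
  obtain ⟨hdk', d1', d2'⟩ := hd'
  obtain ⟨hk1, r1, r2⟩ := hr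
  obtain ⟨T, hT, hT', hTt⟩ : ∃ T, t ≤ T ∧ t' ≤ T ∧ T + 18 ≤ s := ⟨max t t', by omega, by omega, by omega⟩
  obtain ⟨a, b, ha, ha', hb, hb', hab, ⟨u1, u2, -, -⟩, v1, v2, -, -⟩ :=
    pick2 (T + 6) (d2.mono (by omega : t + 6 ≤ T + 6) (by omega : T + 6 + 6 ≤ k))
      (d2'.mono (by omega : t' + 6 ≤ T + 6) (by omega : T + 6 + 6 ≤ k))
      (amo_false _ _) (amo_false _ _)
  obtain ⟨e, f, he, he', hf, hf', hef, ⟨p1, p2, p3, -⟩, q1, q2, q3, -⟩ :=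
    pick2 (T + 12) (r1.mono (by omega : 0 ≤ T + 12) (by omega : T + 12 + 6 ≤ s))
      ((H.e3 a (by omega)).mono (by omega : a ≤ T + 12) (by omega : T + 12 + 6 ≤ k))
      ((H.e3 b (by omega)).mono (by omega : b ≤ T + 12) (by omega : T + 12 + 6 ≤ k))
      (amo_false _ _)
  simp only [not_not] at p2 p3 q2 q3
  exact Y1 (x a) (x b) (y e) (y f) r d d'
    (fun h => hab (H.xinj _ (by omega) _ (by omega) h))
    (fun h => hef (H.yinj _ (by omega) _ (by omega) h))
    p2 q2 p3 q3 hn m m' p1 q1 u1 u2 v1 v2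

/-- thresholds of a row are almost unique -/
lemma thR_unique {r : R} {s s' : ℕ} (h : ThR M k y r s) (h' : ThR M k y r s') :
    s' < s + 18 := by
  by_contra hc
  obtain ⟨-, -, h2⟩ := h
  obtain ⟨hk, h1, -⟩ := h'
  obtain ⟨e, f, he, he', hf, hf', hef, ⟨p1, p2, -, -⟩, -⟩ :=
    pick2 (s + 6) (h1.mono (by omega : 0 ≤ s + 6) (by omega : s + 6 + 6 ≤ s'))
      (h2.mono le_rfl (by omega : s + 6 + 6 ≤ k)) (amo_false _ _) (amo_false _ _)
  exact p2 p1

lemma thC_unique {d : C} {s s' : ℕ} (h : ThC M k x d s) (h' : ThC M k x d s') :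
    s' < s + 18 := by
  by_contra hc
  obtain ⟨-, -, h2⟩ := h
  obtain ⟨hk, h1, -⟩ := h'
  obtain ⟨e, f, he, he', hf, hf', hef, ⟨p1, p2, -, -⟩, -⟩ :=
    pick2 (s + 6) (h1.mono (by omega : 0 ≤ s + 6) (by omega : s + 6 + 6 ≤ s'))
      (h2.mono le_rfl (by omega : s + 6 + 6 ≤ k)) (amo_false _ _) (amo_false _ _)
  exact p1 p2

/-- exact half graph -/
def HG (M : R → C → Prop) (L : ℕ) (r : ℕ → R) (d : ℕ → C) : Prop :=
  ∀ a < L, ∀ b < L, (M (r a) (d b) ↔ a ≤ b)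

lemma HG.rinj {L : ℕ} {r : ℕ → R} {d : ℕ → C} (h : HG M L r d) {a b : ℕ} (ha : a < L) (hb : b < L)
    (hab : r a = r b) : a = b := by
  have h1 := h a ha a ha
  have h2 := h b hb a ha
  have h3 := h b hb b hb
  have h4 := h a ha b hb
  rw [hab] at h1 h4
  simp only [le_refl, iff_true] at h1 h3
  have := h2.1 h1
  have := h4.1 h3
  omega

lemma HG.dinj {L : ℕ} {r : ℕ → R} {d : ℕ → C} (h : HG M L r d) {a b : ℕ} (ha : a < L) (hb : b < L)
    (hab : d a = d b) : a = b := by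
  have h1 := h a ha a ha
  have h2 := h b hb a ha
  have h3 := h b hb b hb
  have h4 := h a ha b hb
  rw [hab] at h1 h2
  simp only [le_refl, iff_true] at h1 h3
  have := h2.1 h3
  have := h4.1 h1
  omega

end NearHalf
section Insertion

variable {R C : Type*} {M : R → C → Prop} {k : ℕ} {x : ℕ → R} {y : ℕ → C}

/-- splice a block of length 100 into a sequence, in place of the indices from `q` on -/
def splice {α : Type*} (q q' : ℕ) (x r : ℕ → α) (i : ℕ) : α :=
  if i < q then x i else if i < q + 100 then r (i - q) else x (i - (q + 100) + q')

lemma splice_low {α : Type*} {q q' : ℕ} {x r : ℕ → α} {i : ℕ} (h : i < q) :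
    splice q q' x r i = x i := by simp [splice, h]

lemma splice_mid {α : Type*} {q q' : ℕ} {x r : ℕ → α} {a : ℕ} (h : a < 100) :
    splice q q' x r (q + a) = r a := by simp [splice, h]

lemma splice_high {α : Type*} {q q' : ℕ} {x r : ℕ → α} {b : ℕ} :
    splice q q' x r (q + 100 + b) = x (q' + b) := by
  have h1 : ¬ (q + 100 + b < q) := by omega
  have h2 : ¬ (q + 100 + b < q + 100) := by omega
  simp only [splice, h1, h2, if_false]
  congr 1
  omega

lemma zone_cases {q k' k q' i : ℕ} (hk' : k' = q + 100 + (k - q')) (hi : i < k') :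
    i < q ∨ (∃ a < 100, i = q + a) ∨ ∃ b, q' + b < k ∧ i = q + 100 + b := by
  by_cases h : i < q
  · exact Or.inl h
  by_cases h2 : i < q + 100
  · exact Or.inr (Or.inl ⟨i - q, by omega, by omega⟩)
  · exact Or.inr (Or.inr ⟨i - (q + 100), by omega, by omega⟩)

lemma NH.insert_clean (Y1 : YF M) (Y2 : YF (fun c r => M r c)) (H : NH M k x y) {s q q' : ℕ}
    (hq : q = s - 35) (hq' : q' = s + 36) (hsk : s ≤ k) {r : ℕ → R} {d : ℕ → C} (hG : HG M 100 r d)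
    {sr : ℕ → ℕ}
    (hr : ∀ a < 100, ThR M k y (r a) (sr a)) (hsr : ∀ a < 100, sr a < s + 18 ∧ s < sr a + 18)
    (hd : ∀ a < 100, ThC M k x (d a) s)
    (hlow : ∀ i < q, q ≤ i + 18 → ∀ a < 100, M (x i) (d a) ∧ ¬ M (r a) (y i))
    (hhigh : ∀ i < k, q' ≤ i → i < q' + 18 → ∀ a < 100, ¬ M (x i) (d a) ∧ M (r a) (y i)) :
    ∃ k' x' y', k < k' ∧ NH M k' x' y' := by
  obtain ⟨k', hk'⟩ : ∃ k', k' = q + 100 + (k - q') := ⟨_, rfl⟩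
  obtain ⟨X, hX⟩ : ∃ X, X = splice q q' x r := ⟨_, rfl⟩
  obtain ⟨Y, hY⟩ : ∃ Y, Y = splice q q' y d := ⟨_, rfl⟩
  obtain ⟨τR, hτR⟩ : ∃ τ, τ = splice q q' id sr := ⟨_, rfl⟩
  obtain ⟨τC, hτC⟩ : ∃ τ, τ = splice q q' id (fun _ => s) := ⟨_, rfl⟩
  have X1 : ∀ i < q, X i = x i := fun i hi => by rw [hX, splice_low hi]
  have X2 : ∀ a < 100, X (q + a) = r a := fun i hi => by rw [hX, splice_mid hi]
  have X3 : ∀ b, X (q + 100 + b) = x (q' + b) := fun i => by rw [hX, splice_high]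
  have Y1' : ∀ i < q, Y i = y i := fun i hi => by rw [hY, splice_low hi]
  have Y2' : ∀ a < 100, Y (q + a) = d a := fun i hi => by rw [hY, splice_mid hi]
  have Y3' : ∀ b, Y (q + 100 + b) = y (q' + b) := fun i => by rw [hY, splice_high]
  have R1 : ∀ i < q, τR i = i := fun i hi => by rw [hτR, splice_low hi]; rfl
  have R2 : ∀ a < 100, τR (q + a) = sr a := fun i hi => by rw [hτR, splice_mid hi]
  have R3 : ∀ b, τR (q + 100 + b) = q' + b := fun i => by rw [hτR, splice_high]; rfl
  have C1 : ∀ i < q, τC i = i := fun i hi => by rw [hτC, splice_low hi]; rfl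
  have C2 : ∀ a < 100, τC (q + a) = s := fun i hi => by rw [hτC, splice_mid hi]
  have C3 : ∀ b, τC (q + 100 + b) = q' + b := fun i => by rw [hτC, splice_high]; rfl
  clear hX hY hτR hτC
  have tR : ∀ i < k', ThR M k y (X i) (τR i) := by
    intro i hi
    rcases zone_cases hk' hi with h | ⟨a, ha, rfl⟩ | ⟨b, hb, rfl⟩
    · rw [X1 i h, R1 i h]; exact H.thR (by omega)
    · rw [X2 a ha, R2 a ha]; exact hr a ha
    · rw [X3, R3]; exact H.thR hb
  have tC : ∀ i < k', ThC M k x (Y i) (τC i) := by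
    intro i hi
    rcases zone_cases hk' hi with h | ⟨a, ha, rfl⟩ | ⟨b, hb, rfl⟩
    · rw [Y1' i h, C1 i h]; exact H.thC (by omega)
    · rw [Y2' a ha, C2 a ha]; exact hd a ha
    · rw [Y3', C3]; exact H.thC hb
  have Xinj : ∀ i < k', ∀ j < k', X i = X j → i = j := by
    intro i hi j hj hij
    have t1 := tR i hi
    have t2 := tR j hj
    rw [← hij] at t2
    have u1 := thR_unique t1 t2
    have u2 := thR_unique t2 t1
    rcases zone_cases hk' hi with h | ⟨a, ha, rfl⟩ | ⟨b, hb, rfl⟩ <;>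
    rcases zone_cases hk' hj with h' | ⟨a', ha', rfl⟩ | ⟨b', hb', rfl⟩
    · rw [X1 i h, X1 j h'] at hij
      exact H.xinj _ (by omega) _ (by omega) hij
    · rw [R1 i h, R2 a' ha'] at u1
      rw [R1 i h, R2 a' ha'] at u2
      have := hsr a' ha'; omega
    · rw [R1 i h, R3] at u1; omega
    · rw [R1 j h', R2 a ha] at u2
      have := hsr a ha; omega
    · rw [X2 a ha, X2 a' ha'] at hij
      rw [hG.rinj ha ha' hij]
    · rw [R2 a ha, R3] at u1
      have := hsr a ha; omega
    · rw [R1 j h', R3] at u2; omega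
    · rw [R2 a' ha', R3] at u2
      have := hsr a' ha'; omega
    · rw [X3, X3] at hij
      have := H.xinj _ hb _ hb' hij; omega
  have Yinj : ∀ i < k', ∀ j < k', Y i = Y j → i = j := by
    intro i hi j hj hij
    have t1 := tC i hi
    have t2 := tC j hj
    rw [← hij] at t2
    have u1 := thC_unique t1 t2
    have u2 := thC_unique t2 t1
    rcases zone_cases hk' hi with h | ⟨a, ha, rfl⟩ | ⟨b, hb, rfl⟩ <;>
    rcases zone_cases hk' hj with h' | ⟨a', ha', rfl⟩ | ⟨b', hb', rfl⟩
    · rw [Y1' i h, Y1' j h'] at hij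
      exact H.yinj _ (by omega) _ (by omega) hij
    · rw [C1 i h, C2 a' ha'] at u1; omega
    · rw [C1 i h, C3] at u1; omega
    · rw [C1 j h', C2 a ha] at u2; omega
    · rw [Y2' a ha, Y2' a' ha'] at hij
      rw [hG.dinj ha ha' hij]
    · rw [C2 a ha, C3] at u1; omega
    · rw [C1 j h', C3] at u2; omega
    · rw [C2 a' ha', C3] at u2; omega
    · rw [Y3', Y3'] at hij
      have := H.yinj _ hb _ hb' hij; omega
  have near : ∀ i < k', ∀ j < k', i < j + 18 → j < i + 18 → (M (X i) (Y j) ↔ i ≤ j) := by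
    intro i hi j hj h1 h2
    rcases zone_cases hk' hi with h | ⟨a, ha, rfl⟩ | ⟨b, hb, rfl⟩ <;>
    rcases zone_cases hk' hj with h' | ⟨a', ha', rfl⟩ | ⟨b', hb', rfl⟩
    · rw [X1 i h, Y1' j h']
      exact H.near _ (by omega) _ (by omega) h1 h2
    · rw [X1 i h, Y2' a' ha']
      exact iff_of_true (hlow i h (by omega) a' ha').1 (by omega)
    · omega
    · rw [X2 a ha, Y1' j h']
      exact iff_of_false (hlow j h' (by omega) a ha).2 (by omega)
    · rw [X2 a ha, Y2' a' ha', hG a ha a' ha']; omega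
    · rw [X2 a ha, Y3']
      exact iff_of_true (hhigh _ hb' (by omega) (by omega) a ha).2 (by omega)
    · omega
    · rw [X3, Y2' a' ha']
      exact iff_of_false (hhigh _ hb (by omega) (by omega) a' ha').1 (by omega)
    · rw [X3, Y3', H.near _ hb _ hb' (by omega) (by omega)]; omega
  have err1 : ∀ i < k', ∀ j < k', i ≤ j → ¬ M (X i) (Y j) → τR i + 18 ≤ τC j := by
    intro i hi j hj hij hM
    rcases zone_cases hk' hi with h | ⟨a, ha, rfl⟩ | ⟨b, hb, rfl⟩ <;>
    rcases zone_cases hk' hj with h' | ⟨a', ha', rfl⟩ | ⟨b', hb', rfl⟩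
    · rw [X1 i h, Y1' j h'] at hM
      rw [R1 i h, C1 j h']
      by_contra hc
      exact hM ((H.near _ (by omega) _ (by omega) (by omega) (by omega)).2 hij)
    · rw [R1 i h, C2 a' ha']; omega
    · rw [R1 i h, C3]; omega
    · omega
    · rw [X2 a ha, Y2' a' ha', hG a ha a' ha'] at hM; omega
    · rw [R2 a ha, C3]
      have := hsr a ha; omega
    · omega
    · omega
    · rw [X3, Y3'] at hM
      rw [R3, C3]
      by_contra hc
      exact hM ((H.near _ (by omega) _ (by omega) (by omega) (by omega)).2 (by omega))
  have err2 : ∀ i < k', ∀ j < k', j < i → M (X i) (Y j) → τC j + 18 ≤ τR i := by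
    intro i hi j hj hij hM
    rcases zone_cases hk' hi with h | ⟨a, ha, rfl⟩ | ⟨b, hb, rfl⟩ <;>
    rcases zone_cases hk' hj with h' | ⟨a', ha', rfl⟩ | ⟨b', hb', rfl⟩
    · rw [X1 i h, Y1' j h'] at hM
      rw [R1 i h, C1 j h']
      by_contra hc
      have := ((H.near _ (by omega) _ (by omega) (by omega) (by omega)).1 hM)
      omega
    · omega
    · omega
    · rw [C1 j h', R2 a ha]
      have := hsr a ha; omega
    · rw [X2 a ha, Y2' a' ha', hG a ha a' ha'] at hM; omega
    · omega
    · rw [C1 j h', R3]; omega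
    · rw [C2 a' ha', R3]; omega
    · rw [X3, Y3'] at hM
      rw [R3, C3]
      by_contra hc
      have := ((H.near _ (by omega) _ (by omega) (by omega) (by omega)).1 hM)
      omega
  refine ⟨k', X, Y, by omega, Xinj, Yinj, near, ?_, ?_, ?_, ?_⟩
  · intro j hj i i' _ hi _ hi' m m'
    by_contra hne
    rcases H.f1 Y2 (tC j hj) (tR i (by omega)) (tR i' (by omega))
      (err1 i (by omega) j hj (by omega) m) (err1 i' (by omega) j hj (by omega) m')
      (fun h => hne (Xinj _ (by omega) _ (by omega) h)) with h | h
    · exact m h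
    · exact m' h
  · intro j hj i i' hi hi2 hi' hi2' m m'
    by_contra hne
    exact H.f2 Y2 (tC j hj) (tR i (by omega)) (tR i' (by omega))
      (err2 i (by omega) j hj (by omega) m) (err2 i' (by omega) j hj (by omega) m')
      (fun h => hne (Xinj _ (by omega) _ (by omega) h)) m m'
  · intro i hi j j' hj hj2 hj' hj2' m m'
    by_contra hne
    rcases H.f3 Y1 (tR i hi) (tC j (by omega)) (tC j' (by omega))
      (err1 i hi j (by omega) (by omega) m) (err1 i hi j' (by omega) (by omega) m')
      (fun h => hne (Yinj _ (by omega) _ (by omega) h)) with h | h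
    · exact m h
    · exact m' h
  · intro i hi j j' hj hj2 hj' hj2' m m'
    by_contra hne
    exact H.f4 Y1 (tR i hi) (tC j (by omega)) (tC j' (by omega))
      (err2 i hi j (by omega) (by omega) m) (err2 i hi j' (by omega) (by omega) m')
      (fun h => hne (Yinj _ (by omega) _ (by omega) h)) m m'

open Classical in
lemma NH.insert (Y1 : YF M) (Y2 : YF (fun c r => M r c)) (H : NH M k x y) {s : ℕ}
    {r : ℕ → R} {d : ℕ → C} (hG : HG M 172 r d) {sr : ℕ → ℕ}
    (hr : ∀ a < 172, ThR M k y (r a) (sr a)) (hsr : ∀ a < 172, sr a < s + 18 ∧ s < sr a + 18)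
    (hd : ∀ a < 172, ThC M k x (d a) s) :
    ∃ k' x' y', k < k' ∧ NH M k' x' y' := by
  obtain ⟨q, hq⟩ : ∃ q, q = s - 35 := ⟨_, rfl⟩
  obtain ⟨q', hq'⟩ : ∃ q', q' = s + 36 := ⟨_, rfl⟩
  have hsk : s ≤ k := (hd 0 (by norm_num)).1
  -- bad sets
  let B1 : ℕ → Finset ℕ := fun c =>
    (Finset.Ico 0 172).filter fun a => c < q ∧ ¬ M (x (q - 1 - c)) (d a)
  let B2 : ℕ → Finset ℕ := fun c => (Finset.Ico 0 172).filter fun a => c < q ∧ M (r a) (y (q - 1 - c))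
  let B3 : ℕ → Finset ℕ := fun c => (Finset.Ico 0 172).filter fun a => q' + c < k ∧ M (x (q' + c)) (d a)
  let B4 : ℕ → Finset ℕ := fun c => (Finset.Ico 0 172).filter fun a => q' + c < k ∧ ¬ M (r a) (y (q' + c))
  have b1 : ∀ c, (B1 c).card ≤ 1 := by
    intro c
    refine AMO.card_le (P := fun a => c < q ∧ ¬ M (x (q - 1 - c)) (d a)) ?_
    rintro a b - ha - hb ⟨hc, m⟩ ⟨-, m'⟩
    by_contra hne
    rcases H.f3 Y1 (H.thR (i := q - 1 - c) (by omega)) (hd a ha) (hd b hb) (by omega) (by omega)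
      (fun h => hne (hG.dinj ha hb h)) with h | h
    · exact m h
    · exact m' h
  have b2 : ∀ c, (B2 c).card ≤ 1 := by
    intro c
    refine AMO.card_le (P := fun a => c < q ∧ M (r a) (y (q - 1 - c))) ?_
    rintro a b - ha - hb ⟨hc, m⟩ ⟨-, m'⟩
    by_contra hne
    have := hsr a ha
    have := hsr b hb
    exact H.f2 Y2 (H.thC (j := q - 1 - c) (by omega)) (hr a ha) (hr b hb) (by omega) (by omega)
      (fun h => hne (hG.rinj ha hb h)) m m'
  have b3 : ∀ c, (B3 c).card ≤ 1 := by
    intro c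
    refine AMO.card_le (P := fun a => q' + c < k ∧ M (x (q' + c)) (d a)) ?_
    rintro a b - ha - hb ⟨hc, m⟩ ⟨-, m'⟩
    by_contra hne
    exact H.f4 Y1 (H.thR (i := q' + c) (by omega)) (hd a ha) (hd b hb) (by omega) (by omega)
      (fun h => hne (hG.dinj ha hb h)) m m'
  have b4 : ∀ c, (B4 c).card ≤ 1 := by
    intro c
    refine AMO.card_le (P := fun a => q' + c < k ∧ ¬ M (r a) (y (q' + c))) ?_
    rintro a b - ha - hb ⟨hc, m⟩ ⟨-, m'⟩
    by_contra hne
    have := hsr a ha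
    have := hsr b hb
    rcases H.f1 Y2 (H.thC (j := q' + c) (by omega)) (hr a ha) (hr b hb) (by omega) (by omega)
      (fun h => hne (hG.rinj ha hb h)) with h | h
    · exact m h
    · exact m' h
  let Bad : Finset ℕ := (Finset.range 18).biUnion fun c => B1 c ∪ B2 c ∪ B3 c ∪ B4 c
  have hBad : Bad.card ≤ 72 := by
    have := Finset.card_biUnion_le_card_mul (Finset.range 18)
      (fun c => B1 c ∪ B2 c ∪ B3 c ∪ B4 c) 4 (by
        intro c _
        have h1 := Finset.card_union_le (B1 c ∪ B2 c ∪ B3 c) (B4 c)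
        have h2 := Finset.card_union_le (B1 c ∪ B2 c) (B3 c)
        have h3 := Finset.card_union_le (B1 c) (B2 c)
        have := b1 c
        have := b2 c
        have := b3 c
        have := b4 c
        omega)
    exact this.trans (by simp)
  have hgood : 100 ≤ (Finset.Ico 0 172 \ Bad).card := by
    have := Finset.le_card_sdiff Bad (Finset.Ico 0 172)
    simp only [Nat.card_Ico] at this
    omega
  let g := Finset.orderEmbOfCardLe _ hgood
  have hg : ∀ a, g a ∈ Finset.Ico 0 172 \ Bad := fun a => Finset.orderEmbOfCardLe_mem _ hgood a
  let G : ℕ → ℕ := fun a => if h : a < 100 then g ⟨a, h⟩ else 0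
  have hGlt : ∀ a < 100, G a < 172 := by
    intro a ha
    have := hg ⟨a, ha⟩
    simp only [Finset.mem_sdiff, Finset.mem_Ico] at this
    simp only [G, ha, dif_pos]
    exact this.1.2
  have hGbad : ∀ a < 100, G a ∉ Bad := by
    intro a ha
    have := hg ⟨a, ha⟩
    simp only [Finset.mem_sdiff] at this
    simp only [G, ha, dif_pos]
    exact this.2
  have hGle : ∀ a < 100, ∀ b < 100, (G a ≤ G b ↔ a ≤ b) := by
    intro a ha b hb
    simp only [G, ha, hb, dif_pos]
    rw [g.le_iff_le]
    simp
  have hclean : ∀ a < 100, ∀ c < 18, G a ∉ B1 c ∧ G a ∉ B2 c ∧ G a ∉ B3 c ∧ G a ∉ B4 c := by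
    intro a ha c hc
    have := hGbad a ha
    simp only [Bad, Finset.mem_biUnion, Finset.mem_range, Finset.mem_union, not_exists, not_and,
      not_or] at this
    obtain ⟨⟨⟨h1, h2⟩, h3⟩, h4⟩ := this c hc
    exact ⟨h1, h2, h3, h4⟩
  refine H.insert_clean Y1 Y2 hq hq' hsk (r := r ∘ G) (d := d ∘ G) (sr := sr ∘ G) ?_ ?_ ?_ ?_ ?_ ?_
  · intro a ha b hb
    simp only [Function.comp]
    rw [hG _ (hGlt a ha) _ (hGlt b hb), hGle a ha b hb]
  · exact fun a ha => hr _ (hGlt a ha)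
  · exact fun a ha => hsr _ (hGlt a ha)
  · exact fun a ha => hd _ (hGlt a ha)
  · intro i hi hi2 a ha
    obtain ⟨h1, h2, -, -⟩ := hclean a ha (q - 1 - i) (by omega)
    have e : q - 1 - (q - 1 - i) = i := by omega
    have e2 : q - 1 - i < q := by omega
    have e3 := hGlt a ha
    simp only [B1, B2, Finset.mem_filter, Finset.mem_Ico, e, e2, e3, true_and, zero_le,
      not_not] at h1 h2
    exact ⟨h1, h2⟩
  · intro i hi hi2 hi3 a ha
    obtain ⟨-, -, h1, h2⟩ := hclean a ha (i - q') (by omega)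
    have e : q' + (i - q') = i := by omega
    have e3 := hGlt a ha
    simp only [B3, B4, Finset.mem_filter, Finset.mem_Ico, e, hi, e3, true_and, zero_le,
      not_not] at h1 h2
    exact ⟨h1, h2⟩

/-- A maximal near half-graph. -/
lemma exists_max_NH [Finite R] [Inhabited R] [Inhabited C] (M : R → C → Prop) :
    ∃ k x y, NH M k x y ∧ ∀ k' x' y', NH M k' x' y' → k' ≤ k := by
  classical
  have : Fintype R := Fintype.ofFinite R
  have hb : ∀ k' x' y', NH M k' x' y' → k' ≤ Fintype.card R := by
    intro k' x' y' H
    have := Fintype.card_le_of_injective (fun i : Fin k' => x' i) (by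
      intro i j hij
      exact Fin.ext (H.xinj _ i.2 _ j.2 hij))
    simpa using this
  let P : ℕ → Prop := fun k => ∃ x y, NH M k x y
  have h0 : P 0 := ⟨fun _ => default, fun _ => default, by
    constructor <;> intro i hi <;> omega⟩
  have hs := Nat.findGreatest_spec (P := P) (Nat.zero_le (Fintype.card R)) h0
  obtain ⟨x, y, H⟩ := hs
  refine ⟨_, x, y, H, ?_⟩
  intro k' x' y' H'
  exact Nat.le_findGreatest (hb _ _ _ H') ⟨x', y', H'⟩

/-- Summary: thresholds. -/
lemma exists_thresholds [Finite R] [Inhabited R] [Inhabited C] (M : R → C → Prop)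
    (Y1 : YF M) (Y2 : YF (fun c r => M r c)) :
    ∃ (k : ℕ) (s : R → ℕ) (t : C → ℕ), k ≤ Nat.card R ∧ (∀ r, s r ≤ k) ∧ (∀ d, t d ≤ k) ∧
      (∀ d r r', s r + 18 ≤ t d → s r' + 18 ≤ t d → ¬ M r d → ¬ M r' d → r = r') ∧
      (∀ d r r', t d + 18 ≤ s r → t d + 18 ≤ s r' → M r d → M r' d → r = r') ∧
      (∀ n : ℕ, ∀ (r : ℕ → R) (d : ℕ → C), HG M 172 r d →
        (∀ a < 172, s (r a) < n + 18 ∧ n < s (r a) + 18) → (∀ a < 172, t (d a) = n) → False) := by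
  classical
  obtain ⟨k, x, y, H, hmax⟩ := exists_max_NH M
  choose s hs using H.exists_thR Y1
  choose t ht using H.exists_thC Y2
  refine ⟨k, s, t, ?_, fun r => (hs r).1, fun d => (ht d).1, ?_, ?_, ?_⟩
  · have : Fintype R := Fintype.ofFinite R
    have := Fintype.card_le_of_injective (fun i : Fin k => x i) (by
      intro i j hij
      exact Fin.ext (H.xinj _ i.2 _ j.2 hij))
    simpa using this
  · intro d r r' h h' m m'
    by_contra hne
    rcases H.f1 Y2 (ht d) (hs r) (hs r') h h' hne with h | h
    · exact m h
    · exact m' h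
  · intro d r r' h h' m m'
    by_contra hne
    exact H.f2 Y2 (ht d) (hs r) (hs r') h h' hne m m'
  · intro n r d hG h1 h2
    obtain ⟨k', x', y', hk, H'⟩ := H.insert Y1 Y2 (s := n) hG (sr := fun a => s (r a))
      (fun a _ => hs _) h1 (fun a ha => by rw [← h2 a ha]; exact ht _)
    have := hmax k' x' y' H'
    omega

end Insertion

/-! ### Part B: doubly lexical orderings and weakly simplicial rows -/

section Lexical

/-- matrix form of chordality of the bipartite graph of `M` -/
def CBM {R C : Type*} (M : R → C → Prop) : Prop :=
  ∀ k : ℕ, 2 ≤ k → ∀ (i : ℕ → R) (j : ℕ → C), ¬ ∀ a ≤ k, ∀ b ≤ k,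
    (M (i a) (j b) ↔ (a = b + 1 ∨ b = a + 1 ∨ (a = 0 ∧ b = 0) ∨ (a = k ∧ b = k)))

/-- rows are lexically ordered -/
def LexR {I J : Type*} [LT I] [LT J] (A : I → J → Prop) : Prop :=
  ∀ i i', i < i' → ∀ j, A i j → ¬ A i' j →
    ∃ j', j < j' ∧ ¬ A i j' ∧ A i' j' ∧ ∀ j'', j' < j'' → (A i j'' ↔ A i' j'')

/-- the configurations arising in the ascent -/
structure Asc {p q : ℕ} (A : Fin p → Fin q → Prop) (k : ℕ) (i : ℕ → Fin p) (j : ℕ → Fin q) :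
    Prop where
  pat : ∀ a ≤ k, ∀ b ≤ k, (A (i a) (j b) ↔ (a = b + 1 ∨ b = a + 1 ∨ (a = 0 ∧ b = 0)))
  imono : ∀ a < k, i a < i (a + 1)
  jmono : ∀ a < k, j a < j (a + 1)
  rows : ∀ a, a + 2 ≤ k → ∀ c, j (a + 2) < c → (A (i a) c ↔ A (i (a + 1)) c)
  cols : ∀ a, a + 2 ≤ k → ∀ c, i (a + 2) < c → (A c (j a) ↔ A c (j (a + 1)))

lemma mono_le_of_step {α : Type*} [Preorder α] {k : ℕ} {f : ℕ → α}
    (h : ∀ a < k, f a < f (a + 1)) {a b : ℕ} (hab : a ≤ b) (hb : b ≤ k) : f a ≤ f b := by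
  induction b, hab using Nat.le_induction with
  | base => exact le_rfl
  | succ n hn ih => exact (ih (by omega)).trans (h n (by omega)).le

lemma asc_zero_aux {α β : Type*} [Preorder β] {B : α → β → Prop} {k : ℕ} {i : ℕ → α} {j : ℕ → β}
    (hj : ∀ a < k, j a < j (a + 1))
    (hr : ∀ a, a + 2 ≤ k → ∀ c, j (a + 2) < c → (B (i a) c ↔ B (i (a + 1)) c))
    {c : β} (hc : j k < c) (h0 : ¬ B (i (k - 1)) c) :
    ∀ m, m + 1 ≤ k → ¬ B (i (k - 1 - m)) c := by
  intro m
  induction m with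
  | zero => intro _; simpa using h0
  | succ m ih =>
    intro hm
    have := ih (by omega)
    rw [hr (k - 1 - (m + 1)) (by omega) c
      ((mono_le_of_step hj (by omega) (by omega)).trans_lt hc)]
    have e : k - 1 - (m + 1) + 1 = k - 1 - m := by omega
    rwa [e]

lemma Asc.step {p q : ℕ} {A : Fin p → Fin q → Prop} (hR : LexR A) (hC : LexR (fun j i => A i j))
    (hB : CBM A) {k : ℕ} (hk : 1 ≤ k) {i : ℕ → Fin p} {j : ℕ → Fin q} (H : Asc A k i j) :
    ∃ i' j', Asc A (k + 1) i' j' := by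
  have ek : k - 1 + 1 = k := by omega
  obtain ⟨c, hc, c1, c2, c3⟩ := hR (i (k - 1)) (i k)
    (by have := H.imono (k - 1) (by omega); rwa [ek] at this) (j k)
    ((H.pat _ (by omega) _ le_rfl).2 (by omega))
    (fun h => by have := (H.pat _ le_rfl _ le_rfl).1 h; omega)
  obtain ⟨r, hr, r1, r2, r3⟩ := hC (j (k - 1)) (j k)
    (by have := H.jmono (k - 1) (by omega); rwa [ek] at this) (i k)
    ((H.pat _ le_rfl _ (by omega)).2 (by omega))
    (fun h => by have := (H.pat _ le_rfl _ le_rfl).1 h; omega)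
  have zc : ∀ a < k, ¬ A (i a) c := by
    intro a ha
    have := asc_zero_aux (B := A) H.jmono H.rows hc c1 (k - 1 - a) (by omega)
    have e : k - 1 - (k - 1 - a) = a := by omega
    rwa [e] at this
  have zr : ∀ a < k, ¬ A r (j a) := by
    intro a ha
    have := asc_zero_aux (B := fun j i => A i j) H.imono H.cols hr r1 (k - 1 - a) (by omega)
    have e : k - 1 - (k - 1 - a) = a := by omega
    rwa [e] at this
  let i' : ℕ → Fin p := fun a => if a ≤ k then i a else r
  let j' : ℕ → Fin q := fun a => if a ≤ k then j a else c
  have i1 : ∀ a ≤ k, i' a = i a := fun a ha => by simp [i', ha]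
  have i2 : i' (k + 1) = r := by simp [i']
  have j1 : ∀ a ≤ k, j' a = j a := fun a ha => by simp [j', ha]
  have j2 : j' (k + 1) = c := by simp [j']
  have pat : ∀ a ≤ k + 1, ∀ b ≤ k + 1, ¬ (a = k + 1 ∧ b = k + 1) →
      (A (i' a) (j' b) ↔ (a = b + 1 ∨ b = a + 1 ∨ (a = 0 ∧ b = 0))) := by
    intro a ha b hb hab
    rcases Nat.lt_or_ge k a with h | h
    · obtain rfl : a = k + 1 := by omega
      rw [i2, j1 b (by omega)]
      rcases Nat.lt_or_ge b k with h' | h'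
      · exact iff_of_false (zr b h') (by omega)
      · obtain rfl : b = k := by omega
        exact iff_of_true r2 (by omega)
    · rw [i1 a h]
      rcases Nat.lt_or_ge k b with h' | h'
      · obtain rfl : b = k + 1 := by omega
        rw [j2]
        rcases Nat.lt_or_ge a k with h'' | h''
        · exact iff_of_false (zc a h'') (by omega)
        · obtain rfl : a = k := by omega
          exact iff_of_true c2 (by omega)
      · rw [j1 b h']
        exact H.pat a h b h'
  have hrc : ¬ A r c := by
    intro h
    refine hB (k + 1) (by omega) i' j' ?_
    intro a ha b hb
    by_cases hab : a = k + 1 ∧ b = k + 1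
    · obtain ⟨rfl, rfl⟩ := hab
      rw [i2, j2]
      exact iff_of_true h (by omega)
    · rw [pat a ha b hb hab]
      omega
  refine ⟨i', j', ?_, ?_, ?_, ?_, ?_⟩
  · intro a ha b hb
    by_cases hab : a = k + 1 ∧ b = k + 1
    · obtain ⟨rfl, rfl⟩ := hab
      rw [i2, j2]
      exact iff_of_false hrc (by omega)
    · exact pat a ha b hb hab
  · intro a ha
    rcases Nat.lt_or_ge a k with h | h
    · rw [i1 a h.le, i1 (a + 1) h]; exact H.imono a h
    · obtain rfl : a = k := by omega
      rw [i1 a le_rfl, i2]; exact hr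
  · intro a ha
    rcases Nat.lt_or_ge a k with h | h
    · rw [j1 a h.le, j1 (a + 1) h]; exact H.jmono a h
    · obtain rfl : a = k := by omega
      rw [j1 a le_rfl, j2]; exact hc
  · intro a ha d hd
    rw [i1 a (by omega), i1 (a + 1) (by omega)]
    rcases Nat.lt_or_ge k (a + 2) with h | h
    · obtain rfl : k = a + 1 := by omega
      rw [j2] at hd
      simpa using c3 d hd
    · rw [j1 _ h] at hd
      exact H.rows a h d hd
  · intro a ha d hd
    rw [j1 a (by omega), j1 (a + 1) (by omega)]
    rcases Nat.lt_or_ge k (a + 2) with h | h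
    · obtain rfl : k = a + 1 := by omega
      rw [i2] at hd
      simpa using r3 d hd
    · rw [i1 _ h] at hd
      exact H.cols a h d hd

lemma no_gamma {p q : ℕ} {A : Fin p → Fin q → Prop} (hR : LexR A) (hC : LexR (fun j i => A i j))
    (hB : CBM A) {i1 i2 : Fin p} {j1 j2 : Fin q} (hi : i1 < i2) (hj : j1 < j2) (h11 : A i1 j1)
    (h12 : A i1 j2) (h21 : A i2 j1) : A i2 j2 := by
  by_contra h22
  have key : ∀ k, 1 ≤ k → ∃ i j, Asc A k i j := by
    intro k hk
    induction k, hk using Nat.le_induction with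
    | base =>
      refine ⟨fun a => if a = 0 then i1 else i2, fun a => if a = 0 then j1 else j2, ?_, ?_, ?_, ?_, ?_⟩
      · intro a ha b hb
        interval_cases a <;> interval_cases b <;> simp_all
      · intro a ha
        interval_cases a
        simpa using hi
      · intro a ha
        interval_cases a
        simpa using hj
      · intro a ha; omega
      · intro a ha; omega
    | succ k hk ih =>
      obtain ⟨i, j, H⟩ := ih
      exact H.step hR hC hB hk
  obtain ⟨i, j, H⟩ := key (p + 1) (by omega)
  have : ∀ a ≤ p + 1, a ≤ (i a).val := by
    intro a
    induction a with
    | zero => intro _; omega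
    | succ a ih =>
      intro ha
      have h1 := ih (by omega)
      have h2 := H.imono a (by omega)
      rw [Fin.lt_def] at h2
      omega
  have h1 := this (p + 1) le_rfl
  have := (i (p + 1)).2
  omega

lemma swap_max {R : Type*} [Fintype R] [DecidableEq R] {p : ℕ} (f : R → ℕ) (σ : R ≃ Fin p)
    (hmax : ∀ σ' : R ≃ Fin p, ∑ r, 2 ^ (σ' r : ℕ) * f r ≤ ∑ r, 2 ^ (σ r : ℕ) * f r)
    {r r' : R} (h : σ r < σ r') : f r ≤ f r' := by
  by_contra hlt
  push Not at hlt
  have hne : r ≠ r' := by rintro rfl; exact lt_irrefl _ h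
  have h1 := hmax ((Equiv.swap r r').trans σ)
  have hz : (∑ x, (2 ^ (((Equiv.swap r r').trans σ) x : ℕ) * f x : ℤ)) - ∑ x, (2 ^ (σ x : ℕ) * f x : ℤ)
      = (2 ^ (σ r' : ℕ) - 2 ^ (σ r : ℕ)) * (f r - f r') := by
    rw [← Finset.sum_sub_distrib, Fintype.sum_eq_add r r' hne]
    · simp
      ring
    · rintro x ⟨hx, hx'⟩
      simp [Equiv.swap_apply_of_ne_of_ne hx hx']
  have h1' : (∑ x, (2 ^ (((Equiv.swap r r').trans σ) x : ℕ) * f x : ℤ)) ≤ ∑ x, (2 ^ (σ x : ℕ) * f x : ℤ) := by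
    exact_mod_cast h1
  have h2 : (0 : ℤ) < (2 ^ (σ r' : ℕ) - 2 ^ (σ r : ℕ)) * (f r - f r') := by
    apply mul_pos
    · have : (2 : ℤ) ^ (σ r : ℕ) < 2 ^ (σ r' : ℕ) := pow_lt_pow_right₀ (by norm_num) h
      linarith
    · have : (f r' : ℤ) < f r := by exact_mod_cast hlt
      linarith
  linarith

open Classical in
lemma lex_of_val {q : ℕ} {B B' : Fin q → Prop}
    (h : ∑ j : Fin q, 2 ^ (j : ℕ) * (if B j then 1 else 0) ≤
      ∑ j : Fin q, 2 ^ (j : ℕ) * (if B' j then 1 else 0)) (j : Fin q) (hj : B j) (hj' : ¬ B' j) :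
    ∃ j', j < j' ∧ ¬ B j' ∧ B' j' ∧ ∀ j'', j' < j'' → (B j'' ↔ B' j'') := by
  have conv : ∀ D : Fin q → Prop, ∑ j : Fin q, 2 ^ (j : ℕ) * (if D j then 1 else 0) =
      ∑ x ∈ (Finset.univ.filter D).map Fin.valEmbedding, 2 ^ x := by
    intro D
    rw [Finset.sum_map, Finset.sum_filter]
    apply Finset.sum_congr rfl
    intro x _
    split_ifs <;> simp
  rw [conv, conv, Finset.geomSum_le_geomSum_iff_toColex_le_toColex le_rfl,
    Finset.Colex.toColex_le_toColex] at h
  have h' : ∀ a, B a → ¬ B' a → ∃ b, B' b ∧ ¬ B b ∧ a ≤ b := by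
    intro a ha ha'
    obtain ⟨b, hb, hb2, hab⟩ := h (a := (a : ℕ)) (by simpa [Fin.val_inj] using ha)
      (by simpa [Fin.val_inj] using ha')
    simp only [Finset.mem_map, Finset.mem_filter, Finset.mem_univ, true_and,
      Fin.valEmbedding_apply] at hb hb2
    obtain ⟨b, hb, rfl⟩ := hb
    exact ⟨b, hb, fun hB => hb2 ⟨b, hB, rfl⟩, hab⟩
  have hne : (Finset.univ.filter fun x => ¬ (B x ↔ B' x)).Nonempty := ⟨j, by simp [hj, hj']⟩
  obtain ⟨m, hm, hmax⟩ := Finset.exists_max_image _ (fun x => x) hne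
  simp only [Finset.mem_filter, Finset.mem_univ, true_and] at hm hmax
  have hjm : j ≤ m := hmax j (by simp [hj, hj'])
  have hm2 : ¬ B m ∧ B' m := by
    by_contra hc
    have hBm : B m ∧ ¬ B' m := by tauto
    obtain ⟨b, hb, hb2, hmb⟩ := h' m hBm.1 hBm.2
    have := hmax b (by tauto)
    have : b = m := le_antisymm this hmb
    subst this
    exact hb2 hBm.1
  refine ⟨m, lt_of_le_of_ne hjm ?_, hm2.1, hm2.2, ?_⟩
  · rintro rfl; exact hm2.1 hj
  · intro x hx
    by_contra hc
    exact absurd (hmax x hc) (not_le.2 hx)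

lemma exists_lex {R C : Type*} [Fintype R] [Fintype C] (M : R → C → Prop) :
    ∃ (p q : ℕ) (σ : R ≃ Fin p) (τ : C ≃ Fin q),
      LexR (fun i j => M (σ.symm i) (τ.symm j)) ∧ LexR (fun j i => M (σ.symm i) (τ.symm j)) := by
  classical
  let Φ : (R ≃ Fin (Fintype.card R)) × (C ≃ Fin (Fintype.card C)) → ℕ := fun z =>
    ∑ r, ∑ c, 2 ^ (z.1 r : ℕ) * (2 ^ (z.2 c : ℕ) * if M r c then 1 else 0)
  have : Nonempty ((R ≃ Fin (Fintype.card R)) × (C ≃ Fin (Fintype.card C))) :=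
    ⟨Fintype.equivFin R, Fintype.equivFin C⟩
  obtain ⟨⟨σ, τ⟩, hmax⟩ := Finite.exists_max Φ
  have hrow : ∀ r r', σ r < σ r' → ∑ c, 2 ^ (τ c : ℕ) * (if M r c then 1 else 0) ≤
      ∑ c, 2 ^ (τ c : ℕ) * (if M r' c then 1 else 0) := by
    intro r r' h
    refine swap_max (fun r => ∑ c, 2 ^ (τ c : ℕ) * (if M r c then 1 else 0)) σ ?_ h
    intro σ'
    have := hmax (σ', τ)
    simpa only [Φ, Finset.mul_sum] using this
  have hcol : ∀ c c', τ c < τ c' → ∑ r, 2 ^ (σ r : ℕ) * (if M r c then 1 else 0) ≤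
      ∑ r, 2 ^ (σ r : ℕ) * (if M r c' then 1 else 0) := by
    intro c c' h
    refine swap_max (fun c => ∑ r, 2 ^ (σ r : ℕ) * (if M r c then 1 else 0)) τ ?_ h
    intro τ'
    have := hmax (σ, τ')
    simp only [Φ] at this
    rw [Finset.sum_comm, Finset.sum_comm (s := Finset.univ) (t := Finset.univ)
      (f := fun r c => 2 ^ (σ r : ℕ) * (2 ^ (τ c : ℕ) * if M r c then 1 else 0))] at this
    simpa only [Finset.mul_sum, mul_left_comm] using this
  refine ⟨_, _, σ, τ, ?_, ?_⟩
  · intro i i' hi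
    refine lex_of_val ?_
    have := hrow (σ.symm i) (σ.symm i') (by simpa using hi)
    rw [← Equiv.sum_comp τ.symm, ← Equiv.sum_comp τ.symm] at this
    simpa using this
  · intro j j' hj
    refine lex_of_val ?_
    have := hcol (τ.symm j) (τ.symm j') (by simpa using hj)
    rw [← Equiv.sum_comp σ.symm, ← Equiv.sum_comp σ.symm] at this
    simpa using this

lemma exists_simplicial {R C : Type*} [Fintype R] [Nonempty R] [Fintype C] {M : R → C → Prop}
    (hB : CBM M) : ∃ v, ∀ c c', M v c → M v c' →
      (∀ r, M r c → M r c') ∨ (∀ r, M r c' → M r c) := by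
  obtain ⟨p, q, σ, τ, hR, hC⟩ := exists_lex M
  have hp : 0 < p := by
    obtain ⟨r⟩ := ‹Nonempty R›
    have := (σ r).2
    omega
  have hB' : CBM (fun i j => M (σ.symm i) (τ.symm j)) := by
    intro k hk i j h
    exact hB k hk (fun a => σ.symm (i a)) (fun a => τ.symm (j a)) h
  have key : ∀ c c', M (σ.symm ⟨0, hp⟩) c → M (σ.symm ⟨0, hp⟩) c' → τ c < τ c' →
      ∀ r, M r c → M r c' := by
    intro c c' h h' hlt r hr
    by_cases h0 : σ r = ⟨0, hp⟩
    · rwa [← h0, Equiv.symm_apply_apply] at h'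
    · have := no_gamma hR hC hB' (i1 := ⟨0, hp⟩) (i2 := σ r) (j1 := τ c) (j2 := τ c')
        (by rw [Fin.lt_def]; exact Nat.pos_of_ne_zero (fun h => h0 (Fin.ext h))) hlt
        (by simpa using h) (by simpa using h') (by simpa using hr)
      simpa using this
  refine ⟨σ.symm ⟨0, hp⟩, ?_⟩
  intro c c' h h'
  rcases lt_trichotomy (τ c) (τ c') with hlt | heq | hgt
  · exact Or.inl (key c c' h h' hlt)
  · rw [τ.injective heq]; exact Or.inl fun _ h => h
  · exact Or.inr (key c' c h' h hgt)

/-- A row of small degree, or a pair of twin columns. -/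
lemma exists_small_or_twin {R C : Type*} [Fintype R] [Nonempty R] [Fintype C] {M : R → C → Prop}
    (hB : CBM M) {L : ℕ} (hL : ∀ r d, ¬ HG M L r d) [Nonempty C] :
    (∃ v, ∃ S : Finset C, S.card < L ∧ ∀ c, M v c ↔ c ∈ S) ∨
      ∃ c c', c ≠ c' ∧ ∀ r, (M r c ↔ M r c') := by
  classical
  by_contra hcon
  push Not at hcon
  obtain ⟨h1, h2⟩ := hcon
  obtain ⟨v, hv⟩ := exists_simplicial hB
  have hS : L ≤ (Finset.univ.filter fun c => M v c).card := by
    by_contra hlt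
    obtain ⟨c, hc⟩ := h1 v (Finset.univ.filter fun c => M v c) (by omega)
    simp at hc
  let f : C → ℕ := fun c => (Finset.univ.filter fun r => M r c).card
  have hsub : ∀ c c', M v c → M v c' → f c ≤ f c' → ∀ r, M r c → M r c' := by
    intro c c' m m' hf
    rcases hv c c' m m' with h | h
    · exact h
    · have hss : (Finset.univ.filter fun r => M r c') ⊆ (Finset.univ.filter fun r => M r c) := by
        intro r hr
        simp only [Finset.mem_filter, Finset.mem_univ, true_and] at hr ⊢
        exact h r hr
      have heq := Finset.eq_of_subset_of_card_le hss hf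
      intro r hr
      have : r ∈ (Finset.univ.filter fun r => M r c) := by simpa using hr
      rw [← heq] at this
      simpa using this
  have hinj : Set.InjOn f (Finset.univ.filter fun c => M v c : Finset C) := by
    intro c hc c' hc' hf
    simp only [Finset.coe_filter, Finset.mem_univ, true_and, Set.mem_ofPred_eq] at hc hc'
    by_contra hne
    rcases h2 c c' hne with ⟨r, hr⟩
    have a1 := hsub c c' hc hc' hf.le r
    have a2 := hsub c' c hc' hc hf.ge r
    tauto
  have hcard : L ≤ ((Finset.univ.filter fun c => M v c).image f).card := by
    rwa [Finset.card_image_of_injOn hinj]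
  let g := Finset.orderEmbOfCardLe _ hcard
  have hg : ∀ a, ∃ c, M v c ∧ f c = g a := by
    intro a
    have := Finset.orderEmbOfCardLe_mem _ hcard a
    simpa using this
  choose d hd hfd using hg
  have hstep : ∀ a b : Fin L, a < b → ∃ r, M r (d b) ∧ ¬ M r (d a) := by
    intro a b hab
    by_contra hc
    push Not at hc
    have hle : f (d b) ≤ f (d a) := by
      apply Finset.card_le_card
      intro r hr
      simp only [Finset.mem_filter, Finset.mem_univ, true_and] at hr ⊢
      exact hc r hr
    rw [hfd, hfd, g.le_iff_le] at hle
    exact absurd hle (not_le.2 hab)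
  have hmono : ∀ a b : Fin L, a ≤ b → ∀ r, M r (d a) → M r (d b) := by
    intro a b hab
    apply hsub _ _ (hd a) (hd b)
    rw [hfd, hfd, g.le_iff_le]
    exact hab
  have hx : ∀ a : ℕ, ∃ r, ∀ ha : a < L, M r (d ⟨a, ha⟩) ∧
      ∀ b, ∀ hb : b < a, ¬ M r (d ⟨b, by omega⟩) := by
    intro a
    by_cases ha : a < L
    · rcases Nat.eq_zero_or_pos a with h0 | h0
      · subst h0
        exact ⟨v, fun _ => ⟨hd _, fun b hb => by omega⟩⟩
      · obtain ⟨r, hr, hr'⟩ := hstep ⟨a - 1, by omega⟩ ⟨a, ha⟩ (by rw [Fin.lt_def]; simp; omega)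
        refine ⟨r, fun _ => ⟨hr, fun b hb h => hr' (hmono ⟨b, by omega⟩ _ ?_ r h)⟩⟩
        rw [Fin.le_def]; simp; omega
    · exact ⟨v, fun h => absurd h ha⟩
  choose x hx using hx
  obtain ⟨c0⟩ := ‹Nonempty C›
  refine hL x (fun b => if hb : b < L then d ⟨b, hb⟩ else c0) ?_
  intro a ha b hb
  simp only [hb, dif_pos]
  constructor
  · intro h
    by_contra hlt
    exact (hx a ha).2 b (by omega) h
  · intro hab
    exact hmono ⟨a, ha⟩ ⟨b, hb⟩ hab _ (hx a ha).1

end Lexical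

/-! ### Part C: counting the local pieces -/

section Local

/-- restriction of a relation to a rectangle -/
def restr {R C : Type*} (M : R → C → Prop) (p : R → Prop) (q : C → Prop) : R → C → Prop :=
  fun r c => M r c ∧ p r ∧ q c

lemma CBM.restr {R C : Type*} {M : R → C → Prop} (h : CBM M) (p : R → Prop) (q : C → Prop) :
    CBM (restr M p q) := by
  intro k hk i j H
  have hp : ∀ a ≤ k, p (i a) := by
    intro a ha
    rcases Nat.eq_zero_or_pos a with h0 | h0
    · exact ((H a ha 0 (by omega)).2 (by omega)).2.1
    · exact ((H a ha (a - 1) (by omega)).2 (by omega)).2.1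
  have hq : ∀ a ≤ k, q (j a) := by
    intro a ha
    rcases Nat.eq_zero_or_pos a with h0 | h0
    · exact ((H 0 (by omega) a ha).2 (by omega)).2.2
    · exact ((H (a - 1) (by omega) a ha).2 (by omega)).2.2
  refine h k hk i j ?_
  intro a ha b hb
  rw [← H a ha b hb]
  exact ⟨fun h => ⟨h, hp a ha, hq b hb⟩, fun h => h.1⟩

lemma HG.of_restr {R C : Type*} {M : R → C → Prop} {p : R → Prop} {q : C → Prop} {L : ℕ}
    {r : ℕ → R} {d : ℕ → C} (H : HG (restr M p q) L r d) :
    HG M L r d ∧ ∀ a < L, p (r a) ∧ q (d a) := by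
  have hpq : ∀ a < L, p (r a) ∧ q (d a) := fun a ha => ((H a ha a ha).2 le_rfl).2
  refine ⟨?_, hpq⟩
  intro a ha b hb
  rw [← H a ha b hb]
  exact ⟨fun h => ⟨h, (hpq a ha).1, (hpq b hb).2⟩, fun h => h.1⟩

set_option linter.unusedSectionVars false

variable {V : Type*} [Fintype V] [DecidableEq V]

/-- local pieces -/
def KP (P Q : Finset V) (M : V → V → Prop) : Prop :=
  (∀ r c, M r c → r ∈ P ∧ c ∈ Q) ∧ CBM M ∧ ∀ r d, ¬ HG M 172 r d

lemma KP.restr {P Q : Finset V} {M : V → V → Prop} (h : KP P Q M) (p q : V → Prop)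
    (P' Q' : Finset V) (hp : ∀ r ∈ P, p r → r ∈ P') (hq : ∀ r ∈ Q, q r → r ∈ Q') :
    KP P' Q' (restr M p q) := by
  refine ⟨?_, h.2.1.restr p q, fun r d H => h.2.2 r d H.of_restr.1⟩
  rintro r c ⟨m, h1, h2⟩
  exact ⟨hp r (h.1 r c m).1 h1, hq c (h.1 r c m).2 h2⟩

/-- elimination labels -/
abbrev XL (V : Type*) := (V × (Fin 172 → Option V)) ⊕ (V × V)

/-- reconstruction from an elimination label -/
def rebuild (x : XL V) (M : V → V → Prop) : V → V → Prop :=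
  match x with
  | Sum.inl z => fun r c => (r = z.1 ∧ ∃ i, z.2 i = some c) ∨ (r ≠ z.1 ∧ M r c)
  | Sum.inr z => fun r c => (c = z.1 ∧ M r z.2) ∨ (c ≠ z.1 ∧ M r c)

lemma exists_list (S : Finset V) (hS : S.card < 172) :
    ∃ nb : Fin 172 → Option V, ∀ c, (∃ i, nb i = some c) ↔ c ∈ S := by
  refine ⟨fun i => if h : i.val < S.card then some (S.equivFin.symm ⟨i, h⟩) else none, ?_⟩
  intro c
  constructor
  · rintro ⟨i, hi⟩
    dsimp only at hi
    split_ifs at hi with h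
    simp only [Option.some.injEq] at hi
    rw [← hi]
    exact Finset.coe_mem _
  · intro hc
    refine ⟨⟨S.equivFin ⟨c, hc⟩, by have := (S.equivFin ⟨c, hc⟩).2; omega⟩, ?_⟩
    simp

lemma KP.decompose {P Q : Finset V} {M : V → V → Prop} (h : KP P Q M) (hP : P.Nonempty)
    (hQ : Q.Nonempty) :
    (∃ v ∈ P, ∃ nb, ∃ M0, KP (P.erase v) Q M0 ∧ rebuild (Sum.inl (v, nb)) M0 = M) ∨
    (∃ c ∈ Q, ∃ c', ∃ M0, KP P (Q.erase c) M0 ∧ rebuild (Sum.inr (c, c')) M0 = M) := by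
  have : Nonempty P := hP.to_subtype
  have : Nonempty Q := hQ.to_subtype
  have hB : CBM (fun (r : P) (c : Q) => M r c) := by
    intro k hk i j H
    exact h.2.1 k hk (fun a => i a) (fun a => j a) H
  have hH : ∀ r d, ¬ HG (fun (r : P) (c : Q) => M r c) 172 r d := by
    intro r d H
    exact h.2.2 (fun a => r a) (fun a => d a) H
  rcases exists_small_or_twin hB hH with ⟨v, S, hS, hvS⟩ | ⟨c, c', hne, hcc⟩
  · left
    obtain ⟨nb, hnb⟩ := exists_list (S.map (Function.Embedding.subtype _))
      (by rwa [Finset.card_map])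
    refine ⟨v, v.2, nb, _, h.restr (fun r => r ≠ v) (fun _ => True) _ _ ?_ (fun _ h _ => h), ?_⟩
    · intro r hr hrv
      exact Finset.mem_erase.2 ⟨hrv, hr⟩
    · funext r c
      simp only [rebuild, _root_.restr, hnb, eq_iff_iff]
      by_cases hr : r = v
      · subst hr
        simp only [true_and, ne_eq, not_true, false_and, or_false, Finset.mem_map,
          Function.Embedding.subtype_apply, Subtype.exists, exists_and_right, exists_eq_right]
        constructor
        · rintro ⟨hc, hcS⟩
          exact (hvS ⟨c, hc⟩).2 hcS
        · intro hm
          exact ⟨(h.1 _ _ hm).2, (hvS ⟨c, (h.1 _ _ hm).2⟩).1 hm⟩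
      · simp [hr]
  · right
    refine ⟨c, c.2, c', _, h.restr (fun _ => True) (fun d => d ≠ c) _ _ (fun _ h _ => h) ?_, ?_⟩
    · intro r hr hrv
      exact Finset.mem_erase.2 ⟨hrv, hr⟩
    · funext r d
      simp only [rebuild, _root_.restr, eq_iff_iff]
      by_cases hd : d = c
      · subst hd
        have hne' : (c' : V) ≠ c := fun h => hne (Subtype.ext h.symm)
        simp only [true_and, ne_eq, not_true, false_and, or_false, hne', not_false_eq_true, and_true]
        constructor
        · intro hm
          exact (hcc ⟨r, (h.1 _ _ hm).1⟩).2 hm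
        · intro hm
          exact (hcc ⟨r, (h.1 _ _ hm).1⟩).1 hm
      · simp [hd]

open Classical in
lemma card_KP [Nonempty V] : ∀ (m : ℕ) (P Q : Finset V), P.card + Q.card = m →
    (Finset.univ.filter (KP P Q)).card ≤ Fintype.card (XL V) ^ m := by
  intro m
  have hX : 0 < Fintype.card (XL V) := by
    have v : V := Classical.arbitrary V
    exact Fintype.card_pos_iff.2 ⟨Sum.inr (v, v)⟩
  induction m with
  | zero =>
    intro P Q h
    have hP : P = ∅ := Finset.card_eq_zero.1 (by omega)
    rw [pow_zero, Finset.card_le_one]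
    intro M hM M' hM'
    simp only [Finset.mem_filter, Finset.mem_univ, true_and] at hM hM'
    funext r c
    rw [eq_iff_iff]
    subst hP
    exact ⟨fun h => absurd (hM.1 r c h).1 (by simp), fun h => absurd (hM'.1 r c h).1 (by simp)⟩
  | succ m ih =>
    intro P Q h
    by_cases hPQ : P.Nonempty ∧ Q.Nonempty
    · let F : XL V → Finset (V → V → Prop) := fun x => match x with
        | Sum.inl z => if z.1 ∈ P then (Finset.univ.filter (KP (P.erase z.1) Q)).image (rebuild x)
            else ∅
        | Sum.inr z => if z.1 ∈ Q then (Finset.univ.filter (KP P (Q.erase z.1))).image (rebuild x)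
            else ∅
      have hsub : Finset.univ.filter (KP P Q) ⊆ Finset.univ.biUnion F := by
        intro M hM
        simp only [Finset.mem_filter, Finset.mem_univ, true_and] at hM
        rw [Finset.mem_biUnion]
        rcases hM.decompose hPQ.1 hPQ.2 with ⟨v, hv, nb, M0, h0, h1⟩ | ⟨c, hc, c', M0, h0, h1⟩
        · refine ⟨Sum.inl (v, nb), Finset.mem_univ _, ?_⟩
          simp only [F, hv, if_true]
          exact Finset.mem_image.2 ⟨M0, by simpa using h0, h1⟩
        · refine ⟨Sum.inr (c, c'), Finset.mem_univ _, ?_⟩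
          simp only [F, hc, if_true]
          exact Finset.mem_image.2 ⟨M0, by simpa using h0, h1⟩
      have hF : ∀ x ∈ (Finset.univ : Finset (XL V)), (F x).card ≤ Fintype.card (XL V) ^ m := by
        rintro (z | z) -
        · simp only [F]
          split_ifs with hz
          · refine Finset.card_image_le.trans (ih _ _ ?_)
            have := Finset.card_erase_add_one hz
            omega
          · simp
        · simp only [F]
          split_ifs with hz
          · refine Finset.card_image_le.trans (ih _ _ ?_)
            have := Finset.card_erase_add_one hz
            omega
          · simp
      refine (Finset.card_le_card hsub).trans ((Finset.card_biUnion_le_card_mul _ _ _ hF).trans ?_)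
      rw [Finset.card_univ, pow_succ, mul_comm]
    · refine le_trans ?_ (Nat.one_le_pow _ _ hX)
      rw [Finset.card_le_one]
      intro M hM M' hM'
      simp only [Finset.mem_filter, Finset.mem_univ, true_and] at hM hM'
      funext r c
      rw [eq_iff_iff]
      exact ⟨fun h => absurd ⟨⟨r, (hM.1 r c h).1⟩, ⟨c, (hM.1 r c h).2⟩⟩ hPQ,
        fun h => absurd ⟨⟨r, (hM'.1 r c h).1⟩, ⟨c, (hM'.1 r c h).2⟩⟩ hPQ⟩

lemma exists_local_code [Nonempty V] (P Q : Finset V) :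
    ∃ e : (V → V → Prop) → (V → XL V) × (V → XL V), ∀ M M', KP P Q M → KP P Q M' →
      (∀ v ∈ P, (e M).1 v = (e M').1 v) → (∀ v ∈ Q, (e M).2 v = (e M').2 v) → M = M' := by
  classical
  have hX : XL V := Sum.inr (Classical.arbitrary V, Classical.arbitrary V)
  have hc : Fintype.card {M // KP P Q M} ≤ Fintype.card (P ⊕ Q → XL V) := by
    rw [Fintype.card_subtype]
    refine (card_KP _ P Q rfl).trans ?_
    rw [Fintype.card_fun, Fintype.card_sum (α := P) (β := Q), Fintype.card_coe, Fintype.card_coe]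
  obtain ⟨φ⟩ := Function.Embedding.nonempty_of_card_le hc
  refine ⟨fun M => (fun v => if h : KP P Q M ∧ v ∈ P then φ ⟨M, h.1⟩ (Sum.inl ⟨v, h.2⟩) else hX,
    fun v => if h : KP P Q M ∧ v ∈ Q then φ ⟨M, h.1⟩ (Sum.inr ⟨v, h.2⟩) else hX), ?_⟩
  intro M M' h h' h1 h2
  have : φ ⟨M, h⟩ = φ ⟨M', h'⟩ := by
    funext z
    rcases z with ⟨v, hv⟩ | ⟨v, hv⟩
    · have := h1 v hv
      simpa [h, h', hv] using this
    · have := h2 v hv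
      simpa [h, h', hv] using this
  have := φ.injective this
  exact congrArg Subtype.val this

end Local

/-! ### Part D: global coding -/

section Global

set_option linter.unusedSectionVars false

variable {V : Type*} [Fintype V] [DecidableEq V]

/-- rows with threshold close to `n` -/
def Ps (s : V → ℕ) (n : ℕ) : Finset V := Finset.univ.filter fun r => s r < n + 18 ∧ n < s r + 18

/-- columns with threshold `n` -/
def Qs (t : V → ℕ) (n : ℕ) : Finset V := Finset.univ.filter fun d => t d = n

/-- local piece at `n` -/
def Mn (M : V → V → Prop) (s t : V → ℕ) (n : ℕ) : V → V → Prop :=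
  restr M (fun r => r ∈ Ps s n) (fun d => d ∈ Qs t n)

/-- a family of local encodings -/
abbrev Enc (V : Type*) :=
  Finset V → Finset V → (V → V → Prop) → (V → XL V) × (V → XL V)

/-- validity of a family of local encodings -/
def EncOK (e : Enc V) : Prop :=
  ∀ P Q M M', KP P Q M → KP P Q M' →
      (∀ v ∈ P, (e P Q M).1 v = (e P Q M').1 v) → (∀ v ∈ Q, (e P Q M).2 v = (e P Q M').2 v) → M = M'

/-- the data of the code are those belonging to `M` -/
structure GoodCode (e : Enc V) (M : V → V → Prop) (s t : V → ℕ) (ms ex : V → Option V)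
    (rc : V → Fin 35 → XL V) (cc : V → XL V) : Prop where
  hms : ∀ d r, s r + 18 ≤ t d → (¬ M r d ↔ ms d = some r)
  hex : ∀ d r, t d + 18 ≤ s r → (M r d ↔ ex d = some r)
  hKP : ∀ n, KP (Ps s n) (Qs t n) (Mn M s t n)
  hrc : ∀ v (δ : Fin 35), rc v δ =
    (e (Ps s (s v + δ - 17)) (Qs t (s v + δ - 17)) (Mn M s t (s v + δ - 17))).1 v
  hcc : ∀ v, cc v = (e (Ps s (t v)) (Qs t (t v)) (Mn M s t (t v))).2 v

lemma GoodCode.unique {e : Enc V} (he : EncOK e) {M M' : V → V → Prop} {s t : V → ℕ}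
    {ms ex : V → Option V} {rc : V → Fin 35 → XL V} {cc : V → XL V}
    (h : GoodCode e M s t ms ex rc cc) (h' : GoodCode e M' s t ms ex rc cc) : M = M' := by
  have hloc : ∀ n, Mn M s t n = Mn M' s t n := by
    intro n
    refine he _ _ _ _ (h.hKP n) (h'.hKP n) ?_ ?_
    · intro v hv
      simp only [Ps, Finset.mem_filter, Finset.mem_univ, true_and] at hv
      have e1 := h.hrc v ⟨n + 17 - s v, by omega⟩
      have e2 := h'.hrc v ⟨n + 17 - s v, by omega⟩
      have e3 : s v + (n + 17 - s v) - 17 = n := by omega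
      simp only [e3] at e1 e2
      rw [← e1, ← e2]
    · intro v hv
      simp only [Qs, Finset.mem_filter, Finset.mem_univ, true_and] at hv
      have e1 := h.hcc v
      have e2 := h'.hcc v
      rw [hv] at e1 e2
      rw [← e1, ← e2]
  funext r d
  rw [eq_iff_iff]
  by_cases h1 : s r + 18 ≤ t d
  · have a := h.hms d r h1
    have b := h'.hms d r h1
    tauto
  by_cases h2 : t d + 18 ≤ s r
  · rw [h.hex d r h2, h'.hex d r h2]
  have hP : r ∈ Ps s (t d) := by
    simp only [Ps, Finset.mem_filter, Finset.mem_univ, true_and]; omega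
  have hQ : d ∈ Qs t (t d) := by simp [Qs]
  have := congrFun (congrFun (hloc (t d)) r) d
  simpa [Mn, restr, hP, hQ] using this

lemma exists_goodCode [Nonempty V] (e : Enc V) {M : V → V → Prop} (Y1 : YF M)
    (Y2 : YF (fun c r => M r c)) (hB : CBM M) :
    ∃ s t ms ex rc cc, (∀ v, s v ≤ Fintype.card V) ∧ (∀ v, t v ≤ Fintype.card V) ∧
      GoodCode e M s t ms ex rc cc := by
  classical
  have : Inhabited V := ⟨Classical.arbitrary V⟩
  obtain ⟨k, s, t, hk, hs, ht, h1, h2, h3⟩ := exists_thresholds M Y1 Y2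
  rw [Nat.card_eq_fintype_card] at hk
  have hm : ∀ d, ∃ o : Option V, ∀ r, s r + 18 ≤ t d → (¬ M r d ↔ o = some r) := by
    intro d
    by_cases hx : ∃ r, s r + 18 ≤ t d ∧ ¬ M r d
    · obtain ⟨r, hr, hm⟩ := hx
      refine ⟨some r, fun r' hr' => ?_⟩
      rw [Option.some.injEq]
      exact ⟨fun hm' => h1 d r r' hr hr' hm hm', fun h => h ▸ hm⟩
    · push Not at hx
      exact ⟨none, fun r hr => by simp [hx r hr]⟩
  have hx : ∀ d, ∃ o : Option V, ∀ r, t d + 18 ≤ s r → (M r d ↔ o = some r) := by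
    intro d
    by_cases hx : ∃ r, t d + 18 ≤ s r ∧ M r d
    · obtain ⟨r, hr, hm⟩ := hx
      refine ⟨some r, fun r' hr' => ?_⟩
      rw [Option.some.injEq]
      exact ⟨fun hm' => h2 d r r' hr hr' hm hm', fun h => h ▸ hm⟩
    · push Not at hx
      exact ⟨none, fun r hr => by simp [hx r hr]⟩
  choose ms hms using hm
  choose ex hex using hx
  refine ⟨s, t, ms, ex, _, _, fun v => (hs v).trans hk, fun v => (ht v).trans hk, hms, hex, ?_,
    fun v δ => rfl, fun v => rfl⟩
  intro n
  refine ⟨fun r c h => h.2, hB.restr _ _, ?_⟩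
  intro r d H
  obtain ⟨H', hpq⟩ := HG.of_restr H
  refine h3 n r d H' ?_ ?_
  · intro a ha
    have := (hpq a ha).1
    simpa [Ps] using this
  · intro a ha
    have := (hpq a ha).2
    simpa [Qs] using this

end Global

section Graphs

variable {V : Type*}

/-- bipartite adjacency relation of a graph with a colouring -/
def BM (G : SimpleGraph V) (f : V → Fin 2) (a b : Fin 2) : V → V → Prop :=
  fun r c => f r = a ∧ f c = b ∧ G.Adj r c

lemma YF_of_free {G : SimpleGraph V} {f : V → Fin 2} (hf : ∀ u v, G.Adj u v → f u ≠ f v)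
    (hY : ¬ Nonempty (Ygraph ↪g G)) {a b : Fin 2} (hab : a ≠ b) : YF (BM G f a b) := by
  intro r1 r2 c1 c2 w d d' hr hc h11 h12 h21 h22 hd hwd hwd' n1 n2 n3 n4 n5 n6
  obtain ⟨fr1, fc1, e11⟩ := h11
  obtain ⟨-, fc2, e12⟩ := h12
  obtain ⟨fr2, -, e21⟩ := h21
  obtain ⟨-, -, e22⟩ := h22
  obtain ⟨fw, fd, ewd⟩ := hwd
  obtain ⟨-, fd', ewd'⟩ := hwd'
  have m1 : ¬ G.Adj w c1 := fun h => n1 ⟨fw, fc1, h⟩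
  have m2 : ¬ G.Adj w c2 := fun h => n2 ⟨fw, fc2, h⟩
  have m3 : ¬ G.Adj r1 d := fun h => n3 ⟨fr1, fd, h⟩
  have m4 : ¬ G.Adj r1 d' := fun h => n4 ⟨fr1, fd', h⟩
  have m5 : ¬ G.Adj r2 d := fun h => n5 ⟨fr2, fd, h⟩
  have m6 : ¬ G.Adj r2 d' := fun h => n6 ⟨fr2, fd', h⟩
  have same : ∀ u v, f u = f v → ¬ G.Adj u v := fun u v h h' => hf u v h' h
  let φ : Fin 7 → V := ![r1, c1, r2, c2, d, w, d']
  have hadj : ∀ i j, i < j → (G.Adj (φ i) (φ j) ↔ Ygraph.Adj i j) ∧ φ i ≠ φ j := by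
    intro i j hij
    fin_cases i <;> fin_cases j <;> first
      | (exfalso; revert hij; decide)
      | skip
    all_goals simp [φ, Ygraph, SimpleGraph.fromRel_adj]
    all_goals grind [SimpleGraph.adj_comm]
  refine hY ⟨⟨⟨φ, ?_⟩, ?_⟩⟩
  · intro i j hij
    rcases lt_trichotomy i j with h | h | h
    · exact absurd hij (hadj i j h).2
    · exact h
    · exact absurd hij.symm (hadj j i h).2
  · intro i j
    change G.Adj (φ i) (φ j) ↔ _
    rcases lt_trichotomy i j with h | h | h
    · exact (hadj i j h).1
    · subst h; simp
    · rw [G.adj_comm, Ygraph.adj_comm]; exact (hadj j i h).1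


lemma cyc_adj {m : ℕ} (u v : Fin m) (hm : 6 ≤ m) : (SimpleGraph.cycleGraph m).Adj u v ↔
    (u.val + 1 = v.val ∨ v.val + 1 = u.val ∨ (u.val = 0 ∧ v.val + 1 = m) ∨
      (v.val = 0 ∧ u.val + 1 = m)) := by
  have hu := u.2
  have hv := v.2
  have key : ∀ a b : Fin m, a < b → (a - b).val = m + a - b ∧ (b - a).val = b - a := fun a b h =>
    ⟨Fin.coe_sub_iff_lt.2 h, Fin.coe_sub_iff_le.2 h.le⟩
  rw [SimpleGraph.cycleGraph_adj']
  rcases lt_trichotomy u v with h | h | h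
  · obtain ⟨h1, h2⟩ := key u v h
    rw [Fin.lt_def] at h
    rw [h1, h2]
    omega
  · subst h
    have : (u - u).val = 0 := by
      rw [Fin.coe_sub_iff_le.2 le_rfl]; omega
    rw [this]
    omega
  · obtain ⟨h1, h2⟩ := key v u h
    rw [Fin.lt_def] at h
    rw [h1, h2]
    omega

lemma exists_cycle {G : SimpleGraph V} {m : ℕ} (hm : 6 ≤ m) (φ : ℕ → V)
    (h : ∀ x < m, ∀ y < m, (G.Adj (φ x) (φ y) ↔
      (x + 1 = y ∨ y + 1 = x ∨ (x = 0 ∧ y + 1 = m) ∨ (y = 0 ∧ x + 1 = m)))) :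
    Nonempty (SimpleGraph.cycleGraph m ↪g G) := by
  have inj : ∀ x < m, ∀ y < m, x < y → φ x ≠ φ y := by
    intro x hx y hy hxy heq
    obtain ⟨z, hz, h1, h2⟩ : ∃ z < m,
        (x + 1 = z ∨ z + 1 = x ∨ (x = 0 ∧ z + 1 = m) ∨ (z = 0 ∧ x + 1 = m)) ∧
        ¬ (y + 1 = z ∨ z + 1 = y ∨ (y = 0 ∧ z + 1 = m) ∨ (z = 0 ∧ y + 1 = m)) := by
      by_cases h2 : y = x + 2
      · rcases Nat.eq_zero_or_pos x with h0 | h0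
        · exact ⟨m - 1, by omega, by omega, by omega⟩
        · exact ⟨x - 1, by omega, by omega, by omega⟩
      · exact ⟨x + 1, by omega, by omega, by omega⟩
    have a1 := (h x hx z hz).2 h1
    rw [heq] at a1
    exact h2 ((h y hy z hz).1 a1)
  refine ⟨⟨⟨fun u => φ u, ?_⟩, ?_⟩⟩
  · intro u v huv
    rcases lt_trichotomy u v with h' | h' | h'
    · exact absurd huv (inj _ u.2 _ v.2 h')
    · exact h'
    · exact absurd huv.symm (inj _ v.2 _ u.2 h')
  · intro u v
    change G.Adj (φ u) (φ v) ↔ _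
    rw [h _ u.2 _ v.2, cyc_adj u v hm]

lemma CBM_of_chordal {G : SimpleGraph V} {f : V → Fin 2} (hf : ∀ u v, G.Adj u v → f u ≠ f v)
    (hY : ∀ m : ℕ, 6 ≤ m → ¬ Nonempty (SimpleGraph.cycleGraph m ↪g G)) (a b : Fin 2) :
    CBM (BM G f a b) := by
  intro k hk i j H
  have fi : ∀ p ≤ k, f (i p) = a := by
    intro p hp
    rcases Nat.eq_zero_or_pos p with h0 | h0
    · exact ((H p hp 0 (by omega)).2 (by omega)).1
    · exact ((H p hp (p - 1) (by omega)).2 (by omega)).1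
  have fj : ∀ p ≤ k, f (j p) = b := by
    intro p hp
    rcases Nat.eq_zero_or_pos p with h0 | h0
    · exact ((H 0 (by omega) p hp).2 (by omega)).2.1
    · exact ((H (p - 1) (by omega) p hp).2 (by omega)).2.1
  have hij : ∀ p ≤ k, ∀ q ≤ k, (G.Adj (i p) (j q) ↔
      (p = q + 1 ∨ q = p + 1 ∨ (p = 0 ∧ q = 0) ∨ (p = k ∧ q = k))) := by
    intro p hp q hq
    rw [← H p hp q hq]
    exact ⟨fun h => ⟨fi p hp, fj q hq, h⟩, fun h => h.2.2⟩
  have hji : ∀ p ≤ k, ∀ q ≤ k, (G.Adj (j q) (i p) ↔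
      (p = q + 1 ∨ q = p + 1 ∨ (p = 0 ∧ q = 0) ∨ (p = k ∧ q = k))) := by
    intro p hp q hq
    rw [G.adj_comm]; exact hij p hp q hq
  have hii : ∀ p ≤ k, ∀ q ≤ k, ¬ G.Adj (i p) (i q) := fun p hp q hq h =>
    hf _ _ h ((fi p hp).trans (fi q hq).symm)
  have hjj : ∀ p ≤ k, ∀ q ≤ k, ¬ G.Adj (j p) (j q) := fun p hp q hq h =>
    hf _ _ h ((fj p hp).trans (fj q hq).symm)
  let φ : ℕ → V := fun x => if x ≤ k then (if x % 2 = 0 then i x else j x)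
    else (if (2 * k + 1 - x) % 2 = 0 then j (2 * k + 1 - x) else i (2 * k + 1 - x))
  refine hY (2 * k + 2) (by omega) (exists_cycle (by omega) φ ?_)
  intro x hx y hy
  simp only [φ]
  split_ifs with h1 h2 h3 h4 h3 h4 h2 h3 h4 h3 h4
  all_goals first
    | (rw [hij _ (by omega) _ (by omega)]; omega)
    | (rw [hji _ (by omega) _ (by omega)]; omega)
    | (exact iff_of_false (hii _ (by omega) _ (by omega)) (by omega))
    | (exact iff_of_false (hjj _ (by omega) _ (by omega)) (by omega))

end Graphs

/-! ### Part E: the upper bound -/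

section Upper

/-- the codes of vertices -/
abbrev VCode (n : ℕ) := Fin 2 × Fin (n + 1) × Fin (n + 1) × Option (Fin n) × Option (Fin n) ×
  (Fin 35 → XL (Fin n)) × XL (Fin n)

lemma upper_card (n : ℕ) (hn : 0 < n) :
    Nat.card {G : SimpleGraph (Fin n) // ChordalBipartite G ∧ ¬ Nonempty (Ygraph ↪g G)} ≤
      Fintype.card (VCode n) ^ n := by
  classical
  have : Nonempty (Fin n) := ⟨⟨0, hn⟩⟩
  choose e he using fun P Q : Finset (Fin n) => exists_local_code P Q
  have heOK : EncOK e := he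
  have hcode : ∀ G : {G : SimpleGraph (Fin n) // ChordalBipartite G ∧ ¬ Nonempty (Ygraph ↪g G)},
      ∃ code : Fin n → VCode n, (∀ u v, G.1.Adj u v → (code u).1 ≠ (code v).1) ∧
        GoodCode e (BM G.1 (fun v => (code v).1) 0 1) (fun v => (code v).2.1.val)
          (fun v => (code v).2.2.1.val) (fun v => (code v).2.2.2.1)
          (fun v => (code v).2.2.2.2.1) (fun v => (code v).2.2.2.2.2.1)
          (fun v => (code v).2.2.2.2.2.2) := by
    rintro ⟨G, ⟨⟨f⟩, hcyc⟩, hY⟩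
    have hf : ∀ u v, G.Adj u v → f u ≠ f v := fun u v h => f.valid h
    obtain ⟨s, t, ms, ex, rc, cc, hs, ht, hgood⟩ := exists_goodCode e (M := BM G f 0 1)
      (YF_of_free hf hY (by decide)) (by
        have := YF_of_free hf hY (a := 1) (b := 0) (by decide)
        have h2 : BM G f 1 0 = fun c r => BM G f 0 1 r c := by
          funext c r
          simp only [BM, eq_iff_iff, G.adj_comm c r]
          tauto
        rwa [h2] at this) (CBM_of_chordal hf hcyc 0 1)
    rw [Fintype.card_fin] at hs ht
    exact ⟨fun v => (f v, ⟨s v, by have := hs v; omega⟩, ⟨t v, by have := ht v; omega⟩, ms v, ex v,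
      rc v, cc v), hf, hgood⟩
  choose code hcol hgood using hcode
  have hinj : Function.Injective code := by
    intro G G' hGG
    have h1 := hgood G
    have h2 := hgood G'
    have c1 := hcol G
    have c2 := hcol G'
    rw [← hGG] at h2 c2
    have hM := h1.unique heOK h2
    have hadj : ∀ u v, (code G u).1 = 0 → (code G v).1 = 1 → (G.1.Adj u v ↔ G'.1.Adj u v) := by
      intro u v hu hv
      have := congrFun (congrFun hM u) v
      simpa [BM, hu, hv] using this
    apply Subtype.ext
    ext u v
    have two : ∀ z : Fin 2, z = 0 ∨ z = 1 := by decide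
    rcases two (code G u).1 with hu | hu <;> rcases two (code G v).1 with hv | hv
    · exact iff_of_false (fun h => c1 u v h (hu.trans hv.symm)) (fun h => c2 u v h (hu.trans hv.symm))
    · exact hadj u v hu hv
    · rw [G.1.adj_comm, G'.1.adj_comm]; exact hadj v u hv hu
    · exact iff_of_false (fun h => c1 u v h (hu.trans hv.symm)) (fun h => c2 u v h (hu.trans hv.symm))
  have := Nat.card_le_card_of_injective code hinj
  rw [Nat.card_eq_fintype_card (α := Fin n → VCode n), Fintype.card_fun, Fintype.card_fin] at this
  exact this

lemma card_XL_le (n : ℕ) : Fintype.card (XL (Fin n)) ≤ (n + 1) ^ 174 := by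
  have h1 : Fintype.card (XL (Fin n)) = n * (n + 1) ^ 172 + n * n := by
    simp [XL]
  rw [h1]
  have h2 : n ≤ (n + 1) ^ 172 := (Nat.le_succ n).trans (Nat.le_self_pow (by norm_num) _)
  calc n * (n + 1) ^ 172 + n * n ≤ n * (n + 1) ^ 172 + n * (n + 1) ^ 172 := by gcongr
    _ = (2 * n) * (n + 1) ^ 172 := by ring
    _ ≤ ((n + 1) ^ 2) * (n + 1) ^ 172 := by gcongr; nlinarith
    _ = (n + 1) ^ 174 := by rw [← pow_add]

lemma card_VCode_le (n : ℕ) (hn : 2 ≤ n) : Fintype.card (VCode n) ≤ n ^ 12538 := by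
  have h1 : Fintype.card (VCode n) = 2 * ((n + 1) * ((n + 1) * ((n + 1) * ((n + 1) *
      (Fintype.card (XL (Fin n)) ^ 35 * Fintype.card (XL (Fin n))))))) := by
    simp only [VCode, Fintype.card_prod, Fintype.card_fin, Fintype.card_option, Fintype.card_fun]
  rw [h1]
  have hX := card_XL_le n
  generalize Fintype.card (XL (Fin n)) = X at hX
  calc 2 * ((n + 1) * ((n + 1) * ((n + 1) * ((n + 1) * (X ^ 35 * X)))))
      = 2 * ((n + 1) ^ 4 * X ^ 36) := by ring
    _ ≤ (n + 1) * ((n + 1) ^ 4 * ((n + 1) ^ 174) ^ 36) := by gcongr; omega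
    _ = (n + 1) ^ 6269 := by
      rw [← pow_mul, ← pow_add, ← pow_succ']
    _ ≤ (n ^ 2) ^ 6269 := by gcongr; nlinarith
    _ = n ^ 12538 := by rw [← pow_mul]

end Upper

/-! ### Part F: the lower bound -/

section Lower

/-- star forests -/
def starG (n m : ℕ) (g : Fin m → Fin m) : SimpleGraph (Fin n) :=
  SimpleGraph.fromRel fun u v => ∃ a : Fin m, u.val = m + a.val ∧ v.val = (g a).val

lemma starG_adj {n m : ℕ} {g : Fin m → Fin m} {u v : Fin n} (h : (starG n m g).Adj u v) :
    (∃ a : Fin m, u.val = m + a.val ∧ v.val = (g a).val) ∨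
      (∃ a : Fin m, v.val = m + a.val ∧ u.val = (g a).val) := by
  rw [starG, SimpleGraph.fromRel_adj] at h
  exact h.2

lemma starG_big {n m : ℕ} {g : Fin m → Fin m} {u v w : Fin n} (h : (starG n m g).Adj u v)
    (h' : (starG n m g).Adj u w) (hu : m ≤ u.val) : v = w := by
  rcases starG_adj h with ⟨a, h1, h2⟩ | ⟨a, h1, h2⟩
  · rcases starG_adj h' with ⟨b, h3, h4⟩ | ⟨b, h3, h4⟩
    · have : a = b := Fin.ext (by omega)
      subst this
      exact Fin.ext (by omega)
    · have := (g b).2; omega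
  · have := (g a).2; omega

lemma starG_nopath {n m : ℕ} {g : Fin m → Fin m} {u v w x : Fin n} (h : (starG n m g).Adj u v)
    (h1 : (starG n m g).Adj u w) (h2 : (starG n m g).Adj v x) (hw : w ≠ v) (hx : x ≠ u) : False := by
  rcases starG_adj h with ⟨a, e1, e2⟩ | ⟨a, e1, e2⟩
  · exact hw (starG_big h1 h (by omega))
  · exact hx (starG_big h2 h.symm (by omega))

lemma starG_mem (n m : ℕ) (g : Fin m → Fin m) :
    ChordalBipartite (starG n m g) ∧ ¬ Nonempty (Ygraph ↪g starG n m g) := by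
  refine ⟨⟨?_, ?_⟩, ?_⟩
  · refine ⟨SimpleGraph.Coloring.mk (fun u => if u.val < m then (0 : Fin 2) else 1) ?_⟩
    intro u v h
    rcases starG_adj h with ⟨a, e1, e2⟩ | ⟨a, e1, e2⟩
    · have h1 : ¬ u.val < m := by omega
      have h2 : v.val < m := by have := (g a).2; omega
      simp [h1, h2]
    · have h1 : ¬ v.val < m := by omega
      have h2 : u.val < m := by have := (g a).2; omega
      simp [h1, h2]
  · rintro k hk ⟨φ⟩
    have adj : ∀ x y (hx : x < k) (hy : y < k), x + 1 = y ∨ y + 1 = x →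
        (starG n m g).Adj (φ ⟨x, hx⟩) (φ ⟨y, hy⟩) := by
      intro x y hx hy h
      rw [φ.map_adj_iff, cyc_adj _ _ hk]
      simp only
      omega
    refine starG_nopath (adj 1 2 (by omega) (by omega) (by omega))
      (adj 1 0 (by omega) (by omega) (by omega)) (adj 2 3 (by omega) (by omega) (by omega)) ?_ ?_
    · intro h
      have := φ.injective h
      simp at this
    · intro h
      have := φ.injective h
      simp at this
  · rintro ⟨φ⟩
    have adj : ∀ x y, Ygraph.Adj x y → (starG n m g).Adj (φ x) (φ y) := fun x y h => φ.map_adj_iff.2 h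
    refine starG_nopath (adj 1 2 (by simp [Ygraph])) (adj 1 0 (by simp [Ygraph]))
      (adj 2 3 (by simp [Ygraph])) ?_ ?_
    · intro h
      exact absurd (φ.injective h) (by decide)
    · intro h
      exact absurd (φ.injective h) (by decide)

lemma starG_inj {n m : ℕ} (hm : 2 * m ≤ n) : Function.Injective (starG n m) := by
  intro g g' h
  funext a
  have ha := a.2
  have hga := (g a).2
  have : (starG n m g).Adj ⟨m + a, by omega⟩ ⟨g a, by omega⟩ := by
    rw [starG, SimpleGraph.fromRel_adj]
    refine ⟨?_, Or.inl ⟨a, rfl, rfl⟩⟩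
    intro he
    rw [Fin.mk.injEq] at he
    omega
  rw [h] at this
  rcases starG_adj this with ⟨b, h1, h2⟩ | ⟨b, h1, h2⟩
  · simp only at h1 h2
    have : a = b := Fin.ext (by omega)
    subst this
    exact Fin.ext h2
  · simp only at h1 h2
    have := (g a).2; omega

lemma lower_card (n : ℕ) : (n / 2) ^ (n / 2) ≤
    Nat.card {G : SimpleGraph (Fin n) // ChordalBipartite G ∧ ¬ Nonempty (Ygraph ↪g G)} := by
  have h := Nat.card_le_card_of_injective
    (fun g : Fin (n / 2) → Fin (n / 2) => (⟨starG n (n / 2) g, starG_mem n (n / 2) g⟩ :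
      {G : SimpleGraph (Fin n) // ChordalBipartite G ∧ ¬ Nonempty (Ygraph ↪g G)}))
    (fun g g' h => starG_inj (by omega) (congrArg Subtype.val h))
  simpa using h

end Lower

/-- The class of `Y`-free chordal bipartite graphs is factorial: for all large `n`, the
number of labelled `Y`-free chordal bipartite graphs on `{1, …, n}` is between
`n^(c₁·n)` and `n^(c₂·n)`. -/
theorem statement16 :
    ∃ c₁ c₂ : ℝ, 0 < c₁ ∧ 0 < c₂ ∧ ∃ N : ℕ, ∀ n : ℕ, N ≤ n →
      (n : ℝ) ^ (c₁ * n) ≤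
        (Nat.card {G : SimpleGraph (Fin n) //
          ChordalBipartite G ∧ ¬ Nonempty (Ygraph ↪g G)} : ℝ) ∧
      (Nat.card {G : SimpleGraph (Fin n) //
          ChordalBipartite G ∧ ¬ Nonempty (Ygraph ↪g G)} : ℝ) ≤ (n : ℝ) ^ (c₂ * n) := by

  refine ⟨1 / 8, 12538, by norm_num, by norm_num, 9, ?_⟩
  intro n hn
  constructor
  · refine le_trans ?_ (Nat.cast_le.2 (lower_card n))
    obtain ⟨m, hm⟩ : ∃ m, m = n / 2 := ⟨_, rfl⟩
    rw [← hm]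
    have h1 : n ≤ m ^ 2 := by
      have : n ≤ 2 * m + 1 := by omega
      have : 4 ≤ m := by omega
      nlinarith
    have h2 : n ≤ 4 * m := by omega
    have h1' : (n : ℝ) ≤ (m : ℝ) ^ (2 : ℝ) := by
      rw [Real.rpow_ofNat]
      exact_mod_cast h1
    have h2' : (n : ℝ) ≤ 4 * m := by exact_mod_cast h2
    have hm1 : (1 : ℝ) ≤ m := by
      have : 1 ≤ m := by omega
      exact_mod_cast this
    calc (n : ℝ) ^ (1 / 8 * (n : ℝ)) ≤ ((m : ℝ) ^ (2 : ℝ)) ^ (1 / 8 * (n : ℝ)) := by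
          apply Real.rpow_le_rpow (by positivity) h1' (by positivity)
      _ = (m : ℝ) ^ (2 * (1 / 8 * (n : ℝ))) := (Real.rpow_mul (by positivity) _ _).symm
      _ ≤ (m : ℝ) ^ (m : ℝ) := by
          apply Real.rpow_le_rpow_of_exponent_le hm1
          linarith
      _ = ((m ^ m : ℕ) : ℝ) := by rw [Real.rpow_natCast]; push_cast; rfl
  · have h := (upper_card n (by omega)).trans (Nat.pow_le_pow_left (card_VCode_le n (by omega)) n)
    rw [← pow_mul] at h
    refine le_trans (Nat.cast_le.2 h) ?_
    have e : (12538 : ℝ) * (n : ℝ) = ((12538 * n : ℕ) : ℝ) := by push_cast; ring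
    rw [e, Real.rpow_natCast, Nat.cast_pow]
end
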